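/- arXiv:1107.4906 — 3 statements merged into one kernel-verified Lean document; each statement's English description precedes it below -/
import Mathlib

section
/- Let P1, P2, P3 be three distinct points of P^1 x P^1 such that no two of them lie on a common rule (their first coordinates are pairwise distinct and their second coordinates are pairwise distinct), and let I = I({P1,P2,P3}) = I(P1) ∩ I(P2) ∩ I(P3). Then I^(m) = I^m for all m ≥ 1, where I^(m) = I(P1)^m ∩ I(P2)^m ∩ I(P3)^m. -/
open MvPolynomial

noncomputable section

/-- The weights giving the bigrading on `k[x0,x1,y0,y1]` with
`deg x0 = deg x1 = (1,0)` and `deg y0 = deg y1 = (0,1)`. -/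
def w4 : Fin 4 → ℕ × ℕ := ![(1,0), (1,0), (0,1), (0,1)]

variable (k : Type*) [Field k]

/-- `p = ((a0,a1),(b0,b1))` represents a point `[a0:a1] × [b0:b1]` of `P^1 × P^1`
if neither pair of coordinates is identically zero. -/
def IsPtRep (p : (k × k) × (k × k)) : Prop := p.1 ≠ 0 ∧ p.2 ≠ 0

/-- Two (nonzero) vectors of `k²` define the same point of `P^1`. -/
def ProjEq (u v : k × k) : Prop := u.1 * v.2 = u.2 * v.1

/-- Two representatives define the same point of `P^1 × P^1`. -/
def PtEq (p q : (k × k) × (k × k)) : Prop := ProjEq k p.1 q.1 ∧ ProjEq k p.2 q.2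

/-- The bihomogeneous ideal of the point `[a0:a1] × [b0:b1]`, namely
`(a1*x0 - a0*x1, b1*y0 - b0*y1)`. -/
def pointIdeal (p : (k × k) × (k × k)) : Ideal (MvPolynomial (Fin 4) k) :=
  Ideal.span {C p.1.2 * X 0 - C p.1.1 * X 1, C p.2.2 * X 2 - C p.2.1 * X 3}

/-- The ideal `I(Z) = ∩ I(P_i)` of a finite tuple of points. -/
def idealOfPoints {s : ℕ} (Z : Fin s → (k × k) × (k × k)) :
    Ideal (MvPolynomial (Fin 4) k) :=
  ⨅ i, pointIdeal k (Z i)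

/-- The `m`-th symbolic power `I(Z)^(m) = ∩ I(P_i)^m`. -/
def symbolicPower {s : ℕ} (Z : Fin s → (k × k) × (k × k)) (m : ℕ) :
    Ideal (MvPolynomial (Fin 4) k) :=
  ⨅ i, (pointIdeal k (Z i)) ^ m

/-- The bigraded piece `J_(i,j)` of a bihomogeneous ideal, as a `k`-subspace. -/
def bipiece (J : Ideal (MvPolynomial (Fin 4) k)) (d : ℕ × ℕ) :
    Submodule k (MvPolynomial (Fin 4) k) :=
  (Submodule.restrictScalars k J) ⊓ (weightedHomogeneousSubmodule k w4 d)

/-- `α(J)`: the least total degree `t = i + j` in which `J` has a nonzero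
bihomogeneous element of bidegree `(i,j)`. -/
def alpha (J : Ideal (MvPolynomial (Fin 4) k)) : ℕ :=
  sInf {t | ∃ F ∈ J, F ≠ 0 ∧ ∃ d : ℕ × ℕ, d.1 + d.2 = t ∧ F.IsWeightedHomogeneous w4 d}

/-- The coordinates of a tuple of points of `P^1 × P^1`, as a point of affine `4s`-space. -/
def coordsOf {s : ℕ} (Z : Fin s → (k × k) × (k × k)) : Fin s × Fin 4 → k :=
  fun p => ![(Z p.1).1.1, (Z p.1).1.2, (Z p.1).2.1, (Z p.1).2.2] p.2

/-- The weights making `k[(P^1 × P^1)^s]` multigraded. -/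
def wProd (s : ℕ) : Fin s × Fin 4 → (Fin s → ℕ × ℕ) := fun p => Pi.single p.1 (w4 p.2)

/-- `GeneralPosition k s P` says that property `P` holds for `s` general points of
`P^1 × P^1`: there is a nonempty Zariski-open subset `U` of `(P^1 × P^1)^s` (the
complement of the zero locus of a multihomogeneous form `G` not vanishing identically)
such that `P` holds for every tuple of pairwise distinct points lying in `U`. -/
def GeneralPosition (s : ℕ) (P : (Fin s → (k × k) × (k × k)) → Prop) : Prop :=
  ∃ (G : MvPolynomial (Fin s × Fin 4) k) (d : Fin s → ℕ × ℕ),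
    G.IsWeightedHomogeneous (wProd s) d ∧
    (∃ Z : Fin s → (k × k) × (k × k), (∀ i, IsPtRep k (Z i)) ∧ eval (coordsOf k Z) G ≠ 0) ∧
    ∀ Z : Fin s → (k × k) × (k × k), (∀ i, IsPtRep k (Z i)) →
      (∀ i j, i ≠ j → ¬ PtEq k (Z i) (Z j)) →
      eval (coordsOf k Z) G ≠ 0 → P Z

/-- Distinct points in multiplicity 1 generic position: every subset `S` imposes
independent conditions in every bidegree, i.e.
`dim_k I(S)_(i,j) = max {0, (i+1)(j+1) - |S|}`. -/
def Mult1Generic {s : ℕ} (Z : Fin s → (k × k) × (k × k)) : Prop :=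
  (∀ i, IsPtRep k (Z i)) ∧ (∀ i j, i ≠ j → ¬ PtEq k (Z i) (Z j)) ∧
  ∀ (S : Finset (Fin s)) (i j : ℕ),
    Module.finrank k ↥(bipiece k (⨅ a ∈ S, pointIdeal k (Z a)) (i, j))
      = (i + 1) * (j + 1) - S.card


namespace ThreePts

/-- Membership in powers via a deformation map into the Rees algebra. -/
theorem rees_step {K : Type*} [Field K] (I : Ideal (MvPolynomial (Fin 4) K))
    (θ : MvPolynomial (Fin 4) K →ₐ[K] Polynomial (MvPolynomial (Fin 4) K))
    (hX : ∀ i, θ (X i) ∈ reesAlgebra I)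
    (h1 : ∀ i, Polynomial.eval 1 (θ (X i)) = X i)
    (hI : ∀ f ∈ I, (Polynomial.X : Polynomial (MvPolynomial (Fin 4) K)) ∣ θ f)
    (q : MvPolynomial (Fin 4) K) (hq0 : q ≠ 0)
    (hq : θ q = Polynomial.X * Polynomial.C q) (m : ℕ) (H : MvPolynomial (Fin 4) K)
    (hH : q * H ∈ I ^ (m + 1)) : H ∈ I ^ m := by
  have hrees : ∀ f, θ f ∈ reesAlgebra I := by
    intro f
    induction f using MvPolynomial.induction_on with
    | C a =>
      have : θ (C a) = algebraMap (MvPolynomial (Fin 4) K) _ (C a) := by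
        have := θ.commutes a
        rw [MvPolynomial.algebraMap_eq] at this
        rw [this]; rfl
      rw [this]
      exact (reesAlgebra I).algebraMap_mem _
    | add p q hp hq => rw [map_add]; exact add_mem hp hq
    | mul_X p i hp => rw [map_mul]; exact mul_mem hp (hX i)
  have heval : ∀ f, Polynomial.eval 1 (θ f) = f := by
    intro f
    induction f using MvPolynomial.induction_on with
    | C a =>
      have : θ (C a) = Polynomial.C (C a) := by
        have := θ.commutes a
        rw [MvPolynomial.algebraMap_eq] at this
        rw [this]; rfl
      rw [this]; simp
    | add p q hp hq => rw [map_add, Polynomial.eval_add, hp, hq]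
    | mul_X p i hp => rw [map_mul, Polynomial.eval_mul, hp, h1]
  have hdvd : ∀ n, ∀ f ∈ I ^ n, (Polynomial.X : Polynomial (MvPolynomial (Fin 4) K)) ^ n ∣ θ f := by
    intro n f hf
    have h2 : I.map θ ≤ Ideal.span {Polynomial.X} := by
      rw [Ideal.map_le_iff_le_comap]
      intro g hg
      exact Ideal.mem_span_singleton.2 (hI g hg)
    have h3 := Ideal.mem_map_of_mem θ hf
    rw [Ideal.map_pow] at h3
    have h4 := Ideal.pow_right_mono h2 n h3
    rwa [Ideal.span_singleton_pow, Ideal.mem_span_singleton] at h4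
  have h5 := hdvd _ _ hH
  rw [map_mul, hq, pow_succ', mul_assoc] at h5
  have h6 := (mul_dvd_mul_iff_left Polynomial.X_ne_zero).1 h5
  rw [Polynomial.X_pow_dvd_iff] at h6
  have h7 : ∀ d < m, (θ H).coeff d = 0 := by
    intro d hd
    have := h6 d hd
    rw [Polynomial.coeff_C_mul] at this
    exact (mul_eq_zero.1 this).resolve_left hq0
  rw [← heval H, Polynomial.eval_eq_sum_range]
  refine Ideal.sum_mem _ fun d _ => ?_
  by_cases hd : d < m
  · simp [h7 d hd]
  · rw [one_pow, mul_one]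
    exact Ideal.pow_le_pow_right (not_lt.1 hd) (hrees H d)

/-- standard ideals -/
def I1 (K : Type*) [Field K] : Ideal (MvPolynomial (Fin 4) K) := Ideal.span {X 0, X 2}
def I2 (K : Type*) [Field K] : Ideal (MvPolynomial (Fin 4) K) := Ideal.span {X 1, X 3}
def I3 (K : Type*) [Field K] : Ideal (MvPolynomial (Fin 4) K) :=
  Ideal.span {X 0 - X 1, X 2 - X 3}
def qq (K : Type*) [Field K] : MvPolynomial (Fin 4) K := X 0 * X 3 - X 1 * X 2

theorem qq_ne (K : Type*) [Field K] : qq K ≠ 0 := by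
  intro h
  have := congrArg (MvPolynomial.eval ![(1 : K), 0, 0, 1]) h
  simp [qq] at this

theorem pair_dvd {K A B : Type*} [Field K] [CommRing A] [CommRing B]
    [Algebra K A] [Algebra K B] (θ : A →ₐ[K] B) (a b : A) (t : B)
    (ha : t ∣ θ a) (hb : t ∣ θ b) : ∀ f ∈ Ideal.span {a, b}, t ∣ θ f := by
  intro f hf
  obtain ⟨c, d, rfl⟩ := Ideal.mem_span_pair.1 hf
  rw [map_add, map_mul, map_mul]
  exact dvd_add (ha.mul_left _) (hb.mul_left _)

theorem mulX_mem {A : Type*} [CommRing A] (I : Ideal A) (a : A) (ha : a ∈ I) :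
    Polynomial.X * Polynomial.C a ∈ reesAlgebra I := by
  rw [Polynomial.X_mul_C, Polynomial.C_mul_X_eq_monomial, reesAlgebra.monomial_mem]
  simpa using ha

theorem C_mem {A : Type*} [CommRing A] (I : Ideal A) (a : A) :
    Polynomial.C a ∈ reesAlgebra I := (reesAlgebra I).algebraMap_mem a

theorem step1 {K : Type*} [Field K] (m : ℕ) (H : MvPolynomial (Fin 4) K)
    (hH : qq K * H ∈ I1 K ^ (m + 1)) : H ∈ I1 K ^ m := by
  have m0 : (X 0 : MvPolynomial (Fin 4) K) ∈ I1 K := Ideal.subset_span (by simp)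
  have m2 : (X 2 : MvPolynomial (Fin 4) K) ∈ I1 K := Ideal.subset_span (by simp)
  refine rees_step (I1 K) (aeval ![Polynomial.X * Polynomial.C (X 0), Polynomial.C (X 1),
    Polynomial.X * Polynomial.C (X 2), Polynomial.C (X 3)]) ?_ ?_ ?_ (qq K) (qq_ne K) ?_ m H hH
  · intro i
    fin_cases i <;> simp [C_mem, mulX_mem, m0, m2, -Polynomial.X_mul_C]
  · intro i
    fin_cases i <;> simp
  · refine pair_dvd _ _ _ _ ?_ ?_ <;> simp
  · simp [qq, -Polynomial.X_mul_C]; ring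

theorem step2 {K : Type*} [Field K] (m : ℕ) (H : MvPolynomial (Fin 4) K)
    (hH : qq K * H ∈ I2 K ^ (m + 1)) : H ∈ I2 K ^ m := by
  have m0 : (X 1 : MvPolynomial (Fin 4) K) ∈ I2 K := Ideal.subset_span (by simp)
  have m2 : (X 3 : MvPolynomial (Fin 4) K) ∈ I2 K := Ideal.subset_span (by simp)
  refine rees_step (I2 K) (aeval ![Polynomial.C (X 0), Polynomial.X * Polynomial.C (X 1),
    Polynomial.C (X 2), Polynomial.X * Polynomial.C (X 3)]) ?_ ?_ ?_ (qq K) (qq_ne K) ?_ m H hH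
  · intro i
    fin_cases i <;> simp [C_mem, mulX_mem, m0, m2, -Polynomial.X_mul_C]
  · intro i
    fin_cases i <;> simp
  · refine pair_dvd _ _ _ _ ?_ ?_ <;> simp
  · simp [qq, -Polynomial.X_mul_C]; ring

theorem step3 {K : Type*} [Field K] (m : ℕ) (H : MvPolynomial (Fin 4) K)
    (hH : qq K * H ∈ I3 K ^ (m + 1)) : H ∈ I3 K ^ m := by
  have m0 : (X 0 - X 1 : MvPolynomial (Fin 4) K) ∈ I3 K := Ideal.subset_span (by simp)
  have m2 : (X 2 - X 3 : MvPolynomial (Fin 4) K) ∈ I3 K := Ideal.subset_span (by simp)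
  refine rees_step (I3 K) (aeval ![Polynomial.C (X 1) + Polynomial.X * Polynomial.C (X 0 - X 1),
    Polynomial.C (X 1), Polynomial.C (X 3) + Polynomial.X * Polynomial.C (X 2 - X 3),
    Polynomial.C (X 3)]) ?_ ?_ ?_ (qq K) (qq_ne K) ?_ m H hH
  · intro i
    fin_cases i
    · simpa [-map_sub, -Polynomial.X_mul_C] using add_mem (C_mem _ _) (mulX_mem _ _ m0)
    · simp [C_mem]
    · simpa [-map_sub, -Polynomial.X_mul_C] using add_mem (C_mem _ _) (mulX_mem _ _ m2)
    · simp [C_mem]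
  · intro i
    fin_cases i <;> simp
  · refine pair_dvd _ _ _ _ ?_ ?_ <;> rw [map_sub] <;> simp [-map_sub]
  · simp [qq, -Polynomial.X_mul_C]; ring

/-- Segre map -/
def seg (K : Type*) [Field K] : MvPolynomial (Fin 4) K →ₐ[K] MvPolynomial (Fin 4) K :=
  aeval ![X 0 * X 2, X 1 * X 2, X 0 * X 3, X 1 * X 3]

/-- normal form section -/
def nf (K : Type*) [Field K] : MvPolynomial (Fin 4) K →ₗ[K] MvPolynomial (Fin 4) K :=
  (MvPolynomial.basisMonomials (Fin 4) K).constr K fun d =>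
    X 0 ^ (d 0 - d 3) * X 1 ^ (d 2 - (d 0 - d 3)) * X 2 ^ (d 3 - (d 3 - d 0)) * X 3 ^ (d 3 - d 0)

theorem mono_eq {K : Type*} [Field K] (d : Fin 4 →₀ ℕ) :
    (monomial d (1 : K)) = X 0 ^ d 0 * X 1 ^ d 1 * X 2 ^ d 2 * X 3 ^ d 3 := by
  rw [MvPolynomial.monomial_eq, Finsupp.prod_fintype _ _ (by simp)]
  simp [Fin.prod_univ_four]

theorem mono_mk {K : Type*} [Field K] (a b c d : ℕ) :
    (X 0 ^ a * X 1 ^ b * X 2 ^ c * X 3 ^ d : MvPolynomial (Fin 4) K) =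
      monomial (Finsupp.equivFunOnFinite.symm ![a, b, c, d]) 1 := by
  rw [mono_eq]; simp

theorem nf_mono {K : Type*} [Field K] (a b c d : ℕ) :
    nf K (X 0 ^ a * X 1 ^ b * X 2 ^ c * X 3 ^ d) =
    X 0 ^ (a - d) * X 1 ^ (c - (a - d)) * X 2 ^ (d - (d - a)) * X 3 ^ (d - a) := by
  rw [mono_mk, nf]
  have := (MvPolynomial.basisMonomials (Fin 4) K).constr_basis K (fun d =>
    (X 0 ^ (d 0 - d 3) * X 1 ^ (d 2 - (d 0 - d 3)) * X 2 ^ (d 3 - (d 3 - d 0)) * X 3 ^ (d 3 - d 0)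
      : MvPolynomial (Fin 4) K))
      (Finsupp.equivFunOnFinite.symm ![a, b, c, d])
  rw [MvPolynomial.coe_basisMonomials] at this
  rw [this]; simp

theorem seg_mono {K : Type*} [Field K] (i j k l : ℕ) :
    seg K (X 0 ^ i * X 1 ^ j * X 2 ^ k * X 3 ^ l) =
    X 0 ^ (i + k) * X 1 ^ (j + l) * X 2 ^ (i + j) * X 3 ^ (k + l) := by
  simp [seg]; ring

theorem nf_seg {K : Type*} [Field K] (F : MvPolynomial (Fin 4) K) :
    qq K ∣ F - nf K (seg K F) := by
  induction F using MvPolynomial.induction_on' with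
  | add p q hp hq =>
    have : p + q - nf K (seg K (p + q)) = (p - nf K (seg K p)) + (q - nf K (seg K q)) := by
      rw [map_add, map_add]; ring
    rw [this]; exact dvd_add hp hq
  | monomial d a =>
    have : monomial d a = a • monomial d (1 : K) := by simp [smul_monomial]
    rw [this, map_smul, map_smul, ← smul_sub, MvPolynomial.smul_eq_C_mul]
    apply Dvd.dvd.mul_left
    rw [mono_eq, seg_mono, nf_mono]
    generalize d 0 = i
    generalize d 1 = j
    generalize d 2 = k
    generalize d 3 = l
    rcases le_total i l with h | h
    · obtain ⟨e, rfl⟩ := Nat.exists_eq_add_of_le h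
      have e1 : i + k - (k + (i + e)) = 0 := by omega
      have e2 : k + (i + e) - (i + k) = e := by omega
      have e3 : k + (i + e) - e = k + i := by omega
      rw [e1, e2, e3]
      have := sub_dvd_pow_sub_pow (X 0 * X 3 : MvPolynomial (Fin 4) K) (X 1 * X 2) i
      refine (this.mul_left (X 1 ^ j * X 2 ^ k * X 3 ^ e)).trans (dvd_of_eq ?_)
      simp only [Nat.sub_zero]
      ring
    · obtain ⟨e, rfl⟩ := Nat.exists_eq_add_of_le h
      have e1 : l + e + k - (k + l) = e := by omega
      have e2 : k + l - (l + e + k) = 0 := by omega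
      have e3 : l + e + j - e = l + j := by omega
      rw [e1, e2, e3]
      have := sub_dvd_pow_sub_pow (X 0 * X 3 : MvPolynomial (Fin 4) K) (X 1 * X 2) l
      refine (this.mul_left (X 1 ^ j * X 2 ^ k * X 0 ^ e)).trans (dvd_of_eq ?_)
      simp only [Nat.sub_zero]
      ring

theorem ker_seg {K : Type*} [Field K] (F : MvPolynomial (Fin 4) K) (h : seg K F = 0) :
    qq K ∣ F := by
  have := nf_seg F
  rwa [h, map_zero, sub_zero] at this

def wt : Fin 4 → ℤ := ![1, 1, -1, -1]

theorem seg_wt {K : Type*} [Field K] (F : MvPolynomial (Fin 4) K) :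
    IsWeightedHomogeneous wt (seg K F) 0 := by
  induction F using MvPolynomial.induction_on with
  | C a => simpa [seg] using isWeightedHomogeneous_C wt a
  | add p q hp hq => rw [map_add]; exact hp.add hq
  | mul_X p i hp =>
    rw [map_mul]
    have h : ∀ a b : Fin 4, wt a + wt b = 0 →
        IsWeightedHomogeneous wt (X a * X b : MvPolynomial (Fin 4) K) 0 := by
      intro a b hab
      have := (isWeightedHomogeneous_X K wt a).mul (isWeightedHomogeneous_X K wt b)
      rwa [hab] at this
    have hi : IsWeightedHomogeneous wt (seg K (X i)) 0 := by
      fin_cases i <;> simp only [seg, aeval_X] <;> exact h _ _ (by simp [wt])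
    simpa using hp.mul hi

def pp (K : Type*) [Field K] : MvPolynomial (Fin 4) K := X 0 * X 1 * (X 0 - X 1)

theorem pp_wt {K : Type*} [Field K] : IsWeightedHomogeneous wt (pp K) 3 := by
  have h0 : IsWeightedHomogeneous wt (X 0 : MvPolynomial (Fin 4) K) 1 := isWeightedHomogeneous_X K wt 0
  have h1 : IsWeightedHomogeneous wt (X 1 : MvPolynomial (Fin 4) K) 1 := isWeightedHomogeneous_X K wt 1
  exact (h0.mul h1).mul (h0.sub h1)

theorem comp_mul {K : Type*} [Field K] (P G : MvPolynomial (Fin 4) K) (i j : ℤ)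
    (hP : IsWeightedHomogeneous wt P i) :
    weightedHomogeneousComponent wt (i + j) (P * G)
      = P * weightedHomogeneousComponent wt j G := by
  induction G using MvPolynomial.induction_on' with
  | add p q hp hq => rw [mul_add, map_add, map_add, hp, hq, mul_add]
  | monomial d a =>
    have h := isWeightedHomogeneous_monomial wt d a (m := Finsupp.weight wt d) rfl
    by_cases hd : Finsupp.weight wt d = j
    · subst hd
      rw [(hP.mul h).weightedHomogeneousComponent_same, h.weightedHomogeneousComponent_same]
    · rw [(hP.mul h).weightedHomogeneousComponent_ne, h.weightedHomogeneousComponent_ne, mul_zero]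
      · exact Ne.symm hd
      · omega

theorem pp_dvd {K : Type*} [Field K] (m : ℕ) (F : MvPolynomial (Fin 4) K)
    (h1 : F ∈ I1 K ^ m) (h2 : F ∈ I2 K ^ m) (h3 : F ∈ I3 K ^ m) :
    pp K ^ m ∣ seg K F := by
  have key : ∀ (I : Ideal (MvPolynomial (Fin 4) K)) (t : MvPolynomial (Fin 4) K),
      (∀ f ∈ I, t ∣ seg K f) → F ∈ I ^ m → t ^ m ∣ seg K F := by
    intro I t hI hF
    have h2 : I.map (seg K) ≤ Ideal.span {t} := by
      rw [Ideal.map_le_iff_le_comap]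
      intro g hg
      exact Ideal.mem_span_singleton.2 (hI g hg)
    have h3 := Ideal.mem_map_of_mem (seg K) hF
    rw [Ideal.map_pow] at h3
    have h4 := Ideal.pow_right_mono h2 m h3
    rwa [Ideal.span_singleton_pow, Ideal.mem_span_singleton] at h4
  have d1 := key (I1 K) (X 0) (pair_dvd _ _ _ _ (by simp [seg]) (by simp [seg])) h1
  have d2 := key (I2 K) (X 1) (pair_dvd _ _ _ _ (by simp [seg]) (by simp [seg])) h2
  have d3 := key (I3 K) (X 0 - X 1) (pair_dvd _ _ _ _ (by simp [seg, ← sub_mul])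
    (by simp [seg, ← sub_mul])) h3
  have nd : ∀ (a : Fin 4) (f : MvPolynomial (Fin 4) K) (v : Fin 4 → K), v a = 0 →
      eval v f ≠ 0 → IsRelPrime (X a) f := by
    intro a f v ha hf
    rw [(X_prime (R := K) (i := a)).irreducible.isRelPrime_iff_not_dvd]
    rintro ⟨g, rfl⟩
    simp [ha] at hf
  have r01 : IsRelPrime (X 0 : MvPolynomial (Fin 4) K) (X 1) :=
    nd 0 _ ![0, 1, 0, 0] (by simp) (by simp)
  have r02 : IsRelPrime (X 0 : MvPolynomial (Fin 4) K) (X 0 - X 1) :=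
    nd 0 _ ![0, 1, 0, 0] (by simp) (by simp)
  have r12 : IsRelPrime (X 1 : MvPolynomial (Fin 4) K) (X 0 - X 1) :=
    nd 1 _ ![1, 0, 0, 0] (by simp) (by simp)
  rw [pp, mul_pow, mul_pow]
  have a1 : IsRelPrime ((X 0 : MvPolynomial (Fin 4) K) ^ m) (X 1 ^ m) := r01.pow
  have a2 : IsRelPrime ((X 0 : MvPolynomial (Fin 4) K) ^ m) ((X 0 - X 1) ^ m) := r02.pow
  have a3 : IsRelPrime ((X 1 : MvPolynomial (Fin 4) K) ^ m) ((X 0 - X 1) ^ m) := r12.pow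
  exact (a2.mul_left a3).mul_dvd (a1.mul_dvd d1 d2) d3

abbrev II (K : Type*) [Field K] : Ideal (MvPolynomial (Fin 4) K) := I1 K ⊓ I2 K ⊓ I3 K

theorem cubic {K : Type*} [Field K] (c d : ℕ) (h : c + d = 3) :
    ∃ g ∈ II K, seg K g = pp K * X 2 ^ c * X 3 ^ d := by
  have x0 : (X 0 : MvPolynomial (Fin 4) K) ∈ I1 K := Ideal.subset_span (by simp)
  have x2 : (X 2 : MvPolynomial (Fin 4) K) ∈ I1 K := Ideal.subset_span (by simp)
  have x1 : (X 1 : MvPolynomial (Fin 4) K) ∈ I2 K := Ideal.subset_span (by simp)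
  have x3 : (X 3 : MvPolynomial (Fin 4) K) ∈ I2 K := Ideal.subset_span (by simp)
  have x01 : (X 0 - X 1 : MvPolynomial (Fin 4) K) ∈ I3 K := Ideal.subset_span (by simp)
  have x23 : (X 2 - X 3 : MvPolynomial (Fin 4) K) ∈ I3 K := Ideal.subset_span (by simp)
  have mk : ∀ f g h : MvPolynomial (Fin 4) K, f ∈ I1 K → g ∈ I2 K → h ∈ I3 K →
      f * g * h ∈ II K := fun f g h hf hg hh =>
    ⟨⟨Ideal.mul_mem_right _ _ (Ideal.mul_mem_right _ _ hf),
      Ideal.mul_mem_right _ _ (Ideal.mul_mem_left _ _ hg)⟩, Ideal.mul_mem_left _ _ hh⟩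
  have hc : c ≤ 3 := by omega
  interval_cases c
  · obtain rfl : d = 3 := by omega
    exact ⟨_, mk _ _ _ x2 x3 x23, by simp [seg, pp]; ring⟩
  · obtain rfl : d = 2 := by omega
    exact ⟨_, mk _ _ _ x0 x3 x23, by simp [seg, pp]; ring⟩
  · obtain rfl : d = 1 := by omega
    exact ⟨_, mk _ _ _ x0 x1 x23, by simp [seg, pp]; ring⟩
  · obtain rfl : d = 0 := by omega
    exact ⟨_, mk _ _ _ x0 x1 x01, by simp [seg, pp]; ring⟩

theorem img0 {K : Type*} [Field K] (i j k l : ℕ) (h : k + l = i + j) :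
    ∃ f : MvPolynomial (Fin 4) K, seg K f = X 0 ^ i * X 1 ^ j * X 2 ^ k * X 3 ^ l := by
  rcases le_total i k with hk | hk
  · obtain ⟨e, rfl⟩ := Nat.exists_eq_add_of_le hk
    obtain rfl : j = e + l := by omega
    exact ⟨X 0 ^ i * X 1 ^ e * X 2 ^ 0 * X 3 ^ l, by rw [seg_mono]; simp⟩
  · obtain ⟨e, rfl⟩ := Nat.exists_eq_add_of_le hk
    obtain rfl : l = e + j := by omega
    exact ⟨X 0 ^ k * X 1 ^ 0 * X 2 ^ e * X 3 ^ j, by rw [seg_mono]; simp⟩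

theorem img {K : Type*} [Field K] (m : ℕ) : ∀ (i j k l : ℕ), k + l = i + j + 3 * m →
    ∃ f ∈ II K ^ m, seg K f = pp K ^ m * (X 0 ^ i * X 1 ^ j * X 2 ^ k * X 3 ^ l) := by
  induction m with
  | zero =>
    intro i j k l h
    obtain ⟨f, hf⟩ := img0 (K := K) i j k l (by omega)
    exact ⟨f, by simp, by simp [hf]⟩
  | succ m ih =>
    intro i j k l h
    obtain ⟨c, d, k', l', hcd, rfl, rfl⟩ : ∃ c d k' l', c + d = 3 ∧ k = c + k' ∧ l = d + l' :=
      ⟨min k 3, 3 - min k 3, k - min k 3, l - (3 - min k 3), by omega, by omega, by omega⟩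
    obtain ⟨f, hf, hf2⟩ := ih i j k' l' (by omega)
    obtain ⟨g, hg, hg2⟩ := cubic (K := K) c d hcd
    refine ⟨f * g, ?_, ?_⟩
    · rw [pow_succ]; exact Ideal.mul_mem_mul hf hg
    · rw [map_mul, hf2, hg2]; ring

theorem img_all {K : Type*} [Field K] (m : ℕ) (G : MvPolynomial (Fin 4) K)
    (hG : IsWeightedHomogeneous wt G (-3 * m)) :
    ∃ f ∈ II K ^ m, seg K f = pp K ^ m * G := by
  have h : pp K ^ m * G ∈ Submodule.map (seg K).toLinearMap ((II K ^ m).restrictScalars K) := by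
    conv => rw [G.as_sum, Finset.mul_sum]
    refine Submodule.sum_mem _ fun d hd => ?_
    have hw := hG (mem_support_iff.1 hd)
    have : monomial d (coeff d G) = coeff d G • monomial d (1 : K) := by simp [smul_monomial]
    rw [this, mul_smul_comm]
    refine Submodule.smul_mem _ _ ?_
    rw [mono_eq]
    obtain ⟨f, hf, hf2⟩ := img (K := K) m (d 0) (d 1) (d 2) (d 3) (by
      rw [Finsupp.weight_apply, Finsupp.sum_fintype _ _ (by simp)] at hw
      simp [Fin.sum_univ_four, wt] at hw
      omega)
    exact ⟨f, hf, hf2⟩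
  obtain ⟨f, hf, hf2⟩ := h
  exact ⟨f, hf, hf2⟩

theorem std {K : Type*} [Field K] (m : ℕ) : I1 K ^ m ⊓ I2 K ^ m ⊓ I3 K ^ m ≤ II K ^ m := by
  induction m with
  | zero => simp
  | succ m ih =>
    rintro F ⟨⟨h1, h2⟩, h3⟩
    obtain ⟨G, hG⟩ := pp_dvd (m + 1) F h1 h2 h3
    have hc := comp_mul (pp K ^ (m + 1)) G _ (-3 * ((m + 1 : ℕ) : ℤ)) (pp_wt.pow (m + 1))
    have hz : (m + 1) • (3 : ℤ) + (-3 * ((m + 1 : ℕ) : ℤ)) = 0 := by simp; ring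
    rw [hz, ← hG, (seg_wt F).weightedHomogeneousComponent_same] at hc
    obtain ⟨f, hf, hf2⟩ := img_all (m + 1) _
      (weightedHomogeneousComponent_isWeightedHomogeneous (w := wt) (-3 * ((m + 1 : ℕ) : ℤ)) G)
    rw [← hc] at hf2
    obtain ⟨H, hH⟩ := ker_seg (F - f) (by rw [map_sub, hf2, sub_self])
    have l1 : II K ≤ I1 K := inf_le_left.trans inf_le_left
    have l2 : II K ≤ I2 K := inf_le_left.trans inf_le_right
    have l3 : II K ≤ I3 K := inf_le_right
    have g1 := step1 m H (hH ▸ sub_mem h1 (Ideal.pow_right_mono l1 _ hf))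
    have g2 := step2 m H (hH ▸ sub_mem h2 (Ideal.pow_right_mono l2 _ hf))
    have g3 := step3 m H (hH ▸ sub_mem h3 (Ideal.pow_right_mono l3 _ hf))
    have hq : qq K ∈ II K := by
      refine ⟨⟨?_, ?_⟩, ?_⟩
      · exact Ideal.mem_span_pair.2 ⟨X 3, -X 1, by simp [qq]; ring⟩
      · exact Ideal.mem_span_pair.2 ⟨-X 2, X 0, by simp [qq]; ring⟩
      · exact Ideal.mem_span_pair.2 ⟨X 3, -X 1, by simp [qq]; ring⟩
    have : F = f + qq K * H := by rw [← hH]; ring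
    rw [this]
    refine add_mem hf ?_
    rw [pow_succ']
    exact Ideal.mul_mem_mul hq (ih ⟨⟨g1, g2⟩, g3⟩)

theorem change {K : Type*} [Field K] (a b c d a' b' c' d' : K) (h : a * d - b * c ≠ 0)
    (h' : a' * d' - b' * c' ≠ 0) :
    ∃ e : MvPolynomial (Fin 4) K ≃ₐ[K] MvPolynomial (Fin 4) K,
      e (X 0) = C a * X 0 + C b * X 1 ∧ e (X 1) = C c * X 0 + C d * X 1 ∧
      e (X 2) = C a' * X 2 + C b' * X 3 ∧ e (X 3) = C c' * X 2 + C d' * X 3 := by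
  obtain ⟨r, hr⟩ : ∃ r, r * (a * d - b * c) = 1 := ⟨_, inv_mul_cancel₀ h⟩
  obtain ⟨r', hr'⟩ : ∃ r, r * (a' * d' - b' * c') = 1 := ⟨_, inv_mul_cancel₀ h'⟩
  have hC : (C r * (C a * C d - C b * C c) : MvPolynomial (Fin 4) K) = 1 := by
    rw [← C_mul, ← C_mul, ← C_sub, ← C_mul, hr, C_1]
  have hC' : (C r' * (C a' * C d' - C b' * C c') : MvPolynomial (Fin 4) K) = 1 := by
    rw [← C_mul, ← C_mul, ← C_sub, ← C_mul, hr', C_1]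
  refine ⟨AlgEquiv.ofAlgHom
    (aeval ![C a * X 0 + C b * X 1, C c * X 0 + C d * X 1, C a' * X 2 + C b' * X 3,
      C c' * X 2 + C d' * X 3])
    (aeval ![C r * (C d * X 0 - C b * X 1), C r * (C a * X 1 - C c * X 0),
      C r' * (C d' * X 2 - C b' * X 3), C r' * (C a' * X 3 - C c' * X 2)]) ?_ ?_, ?_, ?_, ?_, ?_⟩
  · ext1 i
    fin_cases i <;> simp [MvPolynomial.algebraMap_eq]
    · linear_combination X 0 * hC
    · linear_combination X 1 * hC
    · linear_combination X 2 * hC'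
    · linear_combination X 3 * hC'
  · ext1 i
    fin_cases i <;> simp [MvPolynomial.algebraMap_eq]
    · linear_combination X 0 * hC
    · linear_combination X 1 * hC
    · linear_combination X 2 * hC'
    · linear_combination X 3 * hC'
  all_goals simp

theorem span_scale {K : Type*} [Field K] (c d : K) (hc : c ≠ 0) (hd : d ≠ 0)
    (f g : MvPolynomial (Fin 4) K) :
    Ideal.span {C c * f, C d * g} = Ideal.span {f, g} := by
  rw [Ideal.span_insert, Ideal.span_insert,
    Ideal.span_singleton_mul_left_unit ((isUnit_iff_ne_zero.2 hc).map C),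
    Ideal.span_singleton_mul_left_unit ((isUnit_iff_ne_zero.2 hd).map C)]

end ThreePts

/-- For three distinct points of `P^1 × P^1`, no two on a common rule,
`I^(m) = I^m` for all `m ≥ 1`. -/
theorem symbolic_eq_ordinary_three_points {k : Type*} [Field k] [IsAlgClosed k]
    (P1 P2 P3 : (k × k) × (k × k))
    (h1 : IsPtRep k P1) (h2 : IsPtRep k P2) (h3 : IsPtRep k P3)
    (h12a : ¬ ProjEq k P1.1 P2.1) (h12b : ¬ ProjEq k P1.2 P2.2)
    (h13a : ¬ ProjEq k P1.1 P3.1) (h13b : ¬ ProjEq k P1.2 P3.2)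
    (h23a : ¬ ProjEq k P2.1 P3.1) (h23b : ¬ ProjEq k P2.2 P3.2)
    (m : ℕ) (hm : 1 ≤ m) :
    pointIdeal k P1 ^ m ⊓ pointIdeal k P2 ^ m ⊓ pointIdeal k P3 ^ m
      = (pointIdeal k P1 ⊓ pointIdeal k P2 ⊓ pointIdeal k P3) ^ m := by
  obtain ⟨⟨a1, a2⟩, ⟨b1, b2⟩⟩ := P1
  obtain ⟨⟨c1, c2⟩, ⟨d1, d2⟩⟩ := P2
  obtain ⟨⟨e1, e2⟩, ⟨f1, f2⟩⟩ := P3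
  simp only [ProjEq, ← sub_eq_zero (b := _ * _)] at h12a h12b h13a h13b h23a h23b
  -- scaled linear forms x = -D23 l1, u = -D13 l2, so that x - u = D12 l3
  obtain ⟨e, he0, he1, he2, he3⟩ := ThreePts.change
    (-(c1 * e2 - c2 * e1) * a2) ((c1 * e2 - c2 * e1) * a1)
    (-(a1 * e2 - a2 * e1) * c2) ((a1 * e2 - a2 * e1) * c1)
    (-(d1 * f2 - d2 * f1) * b2) ((d1 * f2 - d2 * f1) * b1)
    (-(b1 * f2 - b2 * f1) * d2) ((b1 * f2 - b2 * f1) * d1)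
    (by
      have := mul_ne_zero (mul_ne_zero h23a h13a) h12a
      intro h; apply this; linear_combination h)
    (by
      have := mul_ne_zero (mul_ne_zero h23b h13b) h12b
      intro h; apply this; linear_combination h)
  have m1 : pointIdeal k ((a1, a2), (b1, b2)) = (ThreePts.I1 k).map e := by
    rw [pointIdeal, ThreePts.I1, Ideal.map_span, Set.image_pair, he0, he2,
      ← ThreePts.span_scale (-(c1 * e2 - c2 * e1)) (-(d1 * f2 - d2 * f1))
        (neg_ne_zero.2 h23a) (neg_ne_zero.2 h23b)]
    congr 2
    · simp; ring
    · congr 1; simp; ring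
  have m2 : pointIdeal k ((c1, c2), (d1, d2)) = (ThreePts.I2 k).map e := by
    rw [pointIdeal, ThreePts.I2, Ideal.map_span, Set.image_pair, he1, he3,
      ← ThreePts.span_scale (-(a1 * e2 - a2 * e1)) (-(b1 * f2 - b2 * f1))
        (neg_ne_zero.2 h13a) (neg_ne_zero.2 h13b)]
    congr 2
    · simp; ring
    · congr 1; simp; ring
  have m3 : pointIdeal k ((e1, e2), (f1, f2)) = (ThreePts.I3 k).map e := by
    rw [pointIdeal, ThreePts.I3, Ideal.map_span, Set.image_pair, map_sub, map_sub,
      he0, he1, he2, he3,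
      ← ThreePts.span_scale (a1 * c2 - a2 * c1) (b1 * d2 - b2 * d1) h12a h12b]
    congr 2
    · simp; ring
    · congr 1; simp; ring
  have hcm : ∀ I : Ideal (MvPolynomial (Fin 4) k), I.map e = I.comap e.symm := fun I =>
    Ideal.map_comap_of_equiv (I := I) e.toRingEquiv
  have hinf : ∀ I J : Ideal (MvPolynomial (Fin 4) k), (I ⊓ J).map e = I.map e ⊓ J.map e := by
    intro I J
    rw [hcm, hcm, hcm, Ideal.comap_inf]
  rw [m1, m2, m3]
  apply le_antisymm
  · simp only [← Ideal.map_pow, ← hinf]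
    exact Ideal.map_mono (ThreePts.std m)
  · exact le_inf (le_inf (Ideal.pow_right_mono (inf_le_left.trans inf_le_left) m)
      (Ideal.pow_right_mono (inf_le_left.trans inf_le_right) m))
      (Ideal.pow_right_mono inf_le_right m)
end
end

section
/- Let Z = {P1, ..., P5} be five points of P^1 x P^1 in multiplicity 1 generic position and let I = I(Z). Then I^(m) = I^m for all m ≥ 1. -/
open MvPolynomial

noncomputable section

variable (k : Type*) [Field k]

section FivePoints

set_option linter.unusedSimpArgs false

variable {K : Type*} [Field K]

/-- Shorthand for the polynomial ring. -/
abbrev P4 (K : Type*) [Field K] := MvPolynomial (Fin 4) K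

lemma weight_w4 (d : Fin 4 →₀ ℕ) : Finsupp.weight w4 d = (d 0 + d 1, d 2 + d 3) := by
  rw [Finsupp.weight_apply, Finsupp.sum_fintype _ _ (by simp)]
  simp only [Fin.sum_univ_four, w4]
  ext <;> simp

lemma wh_aeval {d : ℕ × ℕ} (ψ : ℕ × ℕ →+ ℕ × ℕ) (u : Fin 4 → P4 K)
    (hu : ∀ i, (u i).IsWeightedHomogeneous w4 (ψ (w4 i))) {f : P4 K}
    (hf : f.IsWeightedHomogeneous w4 d) :
    (aeval u f).IsWeightedHomogeneous w4 (ψ d) := by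
  induction hf using IsWeightedHomogeneous.induction_on with
  | zero => simpa using isWeightedHomogeneous_zero K w4 _
  | add p q _ _ hp hq => rw [map_add]; exact hp.add hq
  | monomial e r hr =>
    rw [aeval_monomial, Finsupp.prod_fintype _ _ (by simp)]
    have h := IsWeightedHomogeneous.prod Finset.univ (fun i => u i ^ e i) (fun i => e i • ψ (w4 i))
      (w := w4) (fun i _ => (hu i).pow (e i))
    have : ∑ i, e i • ψ (w4 i) = ψ d := by
      rw [← hr, Finsupp.weight_apply, Finsupp.sum_fintype _ _ (by simp), map_sum]
      exact Finset.sum_congr rfl fun i _ => (map_nsmul ψ _ _).symm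
    rw [this] at h
    exact h.C_mul r

lemma aeval_scale {A : Type*} [CommRing A] [Algebra K A] {a b : ℕ} (u0 u1 u2 u3 t : A) {f : P4 K}
    (hf : f.IsWeightedHomogeneous w4 (a, b)) :
    aeval ![u0, u1, t * u2, t * u3] f = t ^ b * aeval ![u0, u1, u2, u3] f := by
  induction hf using IsWeightedHomogeneous.induction_on with
  | zero => simp
  | add p q _ _ hp hq => rw [map_add, map_add, hp, hq]; ring
  | monomial e r hr =>
    rw [weight_w4, Prod.mk.injEq] at hr
    rw [aeval_monomial, aeval_monomial, Finsupp.prod_fintype _ _ (by simp),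
      Finsupp.prod_fintype _ _ (by simp), ← hr.2]
    simp [Fin.prod_univ_four]
    ring

/-- Divide out a homogeneous factor of a homogeneous element: the cofactor can be taken
homogeneous. -/
lemma wh_cofactor {d e : ℕ × ℕ} {f u v : P4 K} (hf : f.IsWeightedHomogeneous w4 d)
    (hu : u.IsWeightedHomogeneous w4 e) (h : f = u * v) :
    (¬ e ≤ d ∧ f = 0) ∨ (e ≤ d ∧ ∃ v', v'.IsWeightedHomogeneous w4 (d - e) ∧ f = u * v') := by
  let _ := weightedGradedAlgebra K w4
  have key := DirectSum.coe_decompose_mul_of_left_mem (weightedHomogeneousSubmodule K w4) (b := v)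
    d (show u ∈ weightedHomogeneousSubmodule K w4 e from hu)
  rw [← h, DirectSum.decompose_of_mem_same _
    (show f ∈ weightedHomogeneousSubmodule K w4 d from hf)] at key
  by_cases hed : e ≤ d
  · right
    rw [if_pos hed] at key
    exact ⟨hed, _, (DirectSum.decompose (weightedHomogeneousSubmodule K w4) v (d - e)).2, key⟩
  · left
    rw [if_neg hed] at key
    exact ⟨hed, key⟩

lemma wh_X (i : Fin 4) : (X i : P4 K).IsWeightedHomogeneous w4 (w4 i) :=
  isWeightedHomogeneous_X K w4 i

/-- the linear form `a1 x0 - a0 x1`. -/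
def lx (a : K × K) : P4 K := C a.2 * X 0 - C a.1 * X 1
/-- the linear form `b1 y0 - b0 y1`. -/
def ly (b : K × K) : P4 K := C b.2 * X 2 - C b.1 * X 3

lemma wh_lx (a : K × K) : (lx a).IsWeightedHomogeneous w4 (1, 0) :=
  ((wh_X 0).C_mul _).sub ((wh_X 1).C_mul _)
lemma wh_ly (a : K × K) : (ly a).IsWeightedHomogeneous w4 (0, 1) :=
  ((wh_X 2).C_mul _).sub ((wh_X 3).C_mul _)

lemma lx_mem (p : (K × K) × (K × K)) : lx p.1 ∈ pointIdeal K p :=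
  Ideal.subset_span (by simp [lx])
lemma ly_mem (p : (K × K) × (K × K)) : ly p.2 ∈ pointIdeal K p :=
  Ideal.subset_span (by simp [ly])

lemma pointIdeal_eq (p : (K × K) × (K × K)) :
    pointIdeal K p = Ideal.span {lx p.1, ly p.2} := rfl

lemma pointIdeal_le_comap {A : Type*} [CommRing A] (g : P4 K →+* A) (p : (K × K) × (K × K))
    (J : Ideal A) (h1 : g (lx p.1) ∈ J) (h2 : g (ly p.2) ∈ J) {f : P4 K} {m : ℕ}
    (hf : f ∈ pointIdeal K p ^ m) : g f ∈ J ^ m := by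
  have h : (pointIdeal K p).map g ≤ J := by
    rw [pointIdeal_eq, Ideal.map_span, Ideal.span_le]
    rintro _ ⟨x, hx, rfl⟩
    rcases hx with rfl | rfl
    · exact h1
    · exact h2
  have := Ideal.mem_map_of_mem g hf
  rw [Ideal.map_pow] at this
  exact Ideal.pow_right_mono h m this

lemma exists_dual (a : K × K) (ha : a ≠ 0) : ∃ e : K × K, a.2 * e.1 - a.1 * e.2 = 1 := by
  by_cases h : a.2 = 0
  · have h1 : a.1 ≠ 0 := fun h1 => ha (Prod.ext h1 h)
    exact ⟨(0, -a.1⁻¹), by simp [h1]⟩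
  · exact ⟨(a.2⁻¹, 0), by simp [h]⟩

lemma lx_ne_zero {a : K × K} (ha : a ≠ 0) : lx a ≠ 0 := by
  obtain ⟨e, he⟩ := exists_dual a ha
  intro h
  have := congrArg (eval ![e.1, e.2, 0, 0]) h
  simp [lx] at this
  rw [he] at this
  exact one_ne_zero this

/-- The substitution scaling the normal directions of the point by `T`. -/
def tau (p e : (K × K) × (K × K)) : P4 K →ₐ[K] Polynomial (P4 K) :=
  aeval ![Polynomial.C (X 0) + (Polynomial.X - 1) * Polynomial.C (C e.1.1 * lx p.1),
    Polynomial.C (X 1) + (Polynomial.X - 1) * Polynomial.C (C e.1.2 * lx p.1),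
    Polynomial.C (X 2) + (Polynomial.X - 1) * Polynomial.C (C e.2.1 * ly p.2),
    Polynomial.C (X 3) + (Polynomial.X - 1) * Polynomial.C (C e.2.2 * ly p.2)]

lemma tau_C (p e : (K × K) × (K × K)) (c : K) : tau p e (C c) = Polynomial.C (C c) := by
  rw [tau, aeval_C]; rfl

lemma tau_lx (p e : (K × K) × (K × K)) (he : p.1.2 * e.1.1 - p.1.1 * e.1.2 = 1) :
    tau p e (lx p.1) = Polynomial.X * Polynomial.C (lx p.1) := by
  have h1 : (C p.1.2 * C e.1.1 - C p.1.1 * C e.1.2 : P4 K) = 1 := by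
    rw [← C_mul, ← C_mul, ← C_sub, he, C_1]
  have h2 := congrArg (Polynomial.C (R := P4 K)) h1
  simp only [Polynomial.C_mul, Polynomial.C_sub, Polynomial.C_1] at h2
  have h3 : Polynomial.C (lx p.1) = Polynomial.C (C p.1.2) * Polynomial.C (X 0)
    - Polynomial.C (C p.1.1) * Polynomial.C (X 1 : P4 K) := by simp [lx]
  have h4 : tau p e (lx p.1) = Polynomial.C (C p.1.2) *
      (Polynomial.C (X 0) + (Polynomial.X - 1) * Polynomial.C (C e.1.1 * lx p.1))
      - Polynomial.C (C p.1.1) *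
      (Polynomial.C (X 1) + (Polynomial.X - 1) * Polynomial.C (C e.1.2 * lx p.1)) := by
    conv_lhs => arg 2; rw [lx]
    rw [map_sub, map_mul, map_mul, tau_C, tau_C, tau, aeval_X, aeval_X]; rfl
  rw [h4, Polynomial.C_mul, Polynomial.C_mul]
  linear_combination (Polynomial.X - 1) * Polynomial.C (lx p.1) * h2 - h3

lemma tau_ly (p e : (K × K) × (K × K)) (he : p.2.2 * e.2.1 - p.2.1 * e.2.2 = 1) :
    tau p e (ly p.2) = Polynomial.X * Polynomial.C (ly p.2) := by
  have h1 : (C p.2.2 * C e.2.1 - C p.2.1 * C e.2.2 : P4 K) = 1 := by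
    rw [← C_mul, ← C_mul, ← C_sub, he, C_1]
  have h2 := congrArg (Polynomial.C (R := P4 K)) h1
  simp only [Polynomial.C_mul, Polynomial.C_sub, Polynomial.C_1] at h2
  have h3 : Polynomial.C (ly p.2) = Polynomial.C (C p.2.2) * Polynomial.C (X 2)
    - Polynomial.C (C p.2.1) * Polynomial.C (X 3 : P4 K) := by simp [ly]
  have h4 : tau p e (ly p.2) = Polynomial.C (C p.2.2) *
      (Polynomial.C (X 2) + (Polynomial.X - 1) * Polynomial.C (C e.2.1 * ly p.2))
      - Polynomial.C (C p.2.1) *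
      (Polynomial.C (X 3) + (Polynomial.X - 1) * Polynomial.C (C e.2.2 * ly p.2)) := by
    conv_lhs => arg 2; rw [ly]
    rw [map_sub, map_mul, map_mul, tau_C, tau_C, tau, aeval_X, aeval_X]; rfl
  rw [h4, Polynomial.C_mul, Polynomial.C_mul]
  linear_combination (Polynomial.X - 1) * Polynomial.C (ly p.2) * h2 - h3

lemma tau_gen_mem {I : Ideal (P4 K)} {x y : P4 K} (hy : y ∈ I) :
    Polynomial.C x + (Polynomial.X - 1) * Polynomial.C y ∈ reesAlgebra I := by
  have : Polynomial.C x + (Polynomial.X - 1) * Polynomial.C y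
      = Polynomial.monomial 0 (x - y) + Polynomial.monomial 1 y := by
    rw [← Polynomial.C_mul_X_eq_monomial, Polynomial.monomial_zero_left, Polynomial.C_sub]; ring
  rw [this]
  exact Subalgebra.add_mem _ (reesAlgebra.monomial_mem.2 (by simp))
    (reesAlgebra.monomial_mem.2 (by simpa using hy))

lemma tau_mem_rees (p e : (K × K) × (K × K)) (f : P4 K) :
    tau p e f ∈ reesAlgebra (pointIdeal K p) := by
  induction f using MvPolynomial.induction_on with
  | C c =>
    have : tau p e (C c) = algebraMap (P4 K) _ (C c) := by rw [tau, aeval_C]; rfl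
    rw [this]; exact Subalgebra.algebraMap_mem _ _
  | add p q hp hq => rw [map_add]; exact Subalgebra.add_mem _ hp hq
  | mul_X f i hf =>
    rw [map_mul]
    refine Subalgebra.mul_mem _ hf ?_
    rw [tau, aeval_X]
    fin_cases i
    · exact tau_gen_mem (Ideal.mul_mem_left _ _ (lx_mem p))
    · exact tau_gen_mem (Ideal.mul_mem_left _ _ (lx_mem p))
    · exact tau_gen_mem (Ideal.mul_mem_left _ _ (ly_mem p))
    · exact tau_gen_mem (Ideal.mul_mem_left _ _ (ly_mem p))

lemma tau_eval_one (p e : (K × K) × (K × K)) (f : P4 K) :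
    Polynomial.eval 1 (tau p e f) = f := by
  induction f using MvPolynomial.induction_on with
  | C c =>
    have : tau p e (C c) = Polynomial.C (C c) := by rw [tau, aeval_C]; rfl
    rw [this]; simp
  | add p q hp hq => rw [map_add, Polynomial.eval_add, hp, hq]
  | mul_X f i hf =>
    rw [map_mul, Polynomial.eval_mul, hf]
    congr 1
    rw [tau, aeval_X]
    fin_cases i <;> simp

/-- Membership in powers of a point ideal, via the order in `T`. -/
lemma mem_pow_iff {p e : (K × K) × (K × K)} (he1 : p.1.2 * e.1.1 - p.1.1 * e.1.2 = 1)
    (he2 : p.2.2 * e.2.1 - p.2.1 * e.2.2 = 1) (f : P4 K) (m : ℕ) :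
    f ∈ pointIdeal K p ^ m ↔ Polynomial.X ^ m ∣ tau p e f := by
  constructor
  · intro hf
    rw [← Ideal.mem_span_singleton, ← Ideal.span_singleton_pow]
    refine pointIdeal_le_comap (tau p e).toRingHom p _ ?_ ?_ hf
    · rw [Ideal.mem_span_singleton]; exact ⟨_, tau_lx p e he1⟩
    · rw [Ideal.mem_span_singleton]; exact ⟨_, tau_ly p e he2⟩
  · intro h
    rw [Polynomial.X_pow_dvd_iff] at h
    rw [← tau_eval_one p e f, Polynomial.eval_eq_sum]
    refine Ideal.sum_mem _ fun i _ => ?_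
    simp only [one_pow, mul_one]
    by_cases hi : i < m
    · simp [h i hi]
    · exact Ideal.pow_le_pow_right (not_lt.1 hi) (tau_mem_rees p e f i)

lemma exists_dual2 {p : (K × K) × (K × K)} (hp : IsPtRep K p) : ∃ e : (K × K) × (K × K),
    p.1.2 * e.1.1 - p.1.1 * e.1.2 = 1 ∧ p.2.2 * e.2.1 - p.2.1 * e.2.2 = 1 := by
  obtain ⟨e1, h1⟩ := exists_dual _ hp.1
  obtain ⟨e2, h2⟩ := exists_dual _ hp.2
  exact ⟨(e1, e2), h1, h2⟩

lemma pt_prime {p : (K × K) × (K × K)} (hp : IsPtRep K p) {f g : P4 K}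
    (h : f * g ∈ pointIdeal K p) : f ∈ pointIdeal K p ∨ g ∈ pointIdeal K p := by
  obtain ⟨e, h1, h2⟩ := exists_dual2 hp
  have key := fun f => mem_pow_iff h1 h2 f 1
  simp only [pow_one] at key
  rw [key, map_mul] at h
  rw [key, key]
  exact Polynomial.prime_X.dvd_or_dvd h

lemma pt_prime_pow {p : (K × K) × (K × K)} (hp : IsPtRep K p) {f g : P4 K} {r : ℕ}
    (h : f ^ r * g ∈ pointIdeal K p) : f ∈ pointIdeal K p ∨ g ∈ pointIdeal K p := by
  induction r with
  | zero => right; simpa using h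
  | succ r ih =>
    rw [pow_succ', mul_assoc] at h
    rcases pt_prime hp h with h | h
    · exact Or.inl h
    · exact ih h

/-- Cancelling an element of order at most one. -/
lemma pt_cancel {p : (K × K) × (K × K)} (hp : IsPtRep K p) {u v : P4 K} {m : ℕ}
    (hu : u ∉ pointIdeal K p ^ 2) (h : u * v ∈ pointIdeal K p ^ (m + 1)) :
    v ∈ pointIdeal K p ^ m := by
  obtain ⟨e, h1, h2⟩ := exists_dual2 hp
  rw [mem_pow_iff h1 h2] at hu h ⊢
  rw [map_mul] at h
  by_cases hd : Polynomial.X ∣ tau p e u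
  · obtain ⟨w, hw⟩ := hd
    have hw' : ¬ Polynomial.X ∣ w := by
      rintro ⟨z, rfl⟩
      exact hu ⟨z, by rw [hw]; ring⟩
    rw [hw, pow_succ', mul_assoc] at h
    have h := (mul_dvd_mul_iff_left Polynomial.X_ne_zero).1 h
    exact Polynomial.prime_X.pow_dvd_of_dvd_mul_left m hw' h
  · exact (pow_dvd_pow _ (Nat.le_succ m)).trans
      (Polynomial.prime_X.pow_dvd_of_dvd_mul_left _ hd h)

lemma lx_mul_not_mem {p : (K × K) × (K × K)} (hp : IsPtRep K p) {u : P4 K}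
    (hu : u ∉ pointIdeal K p) : lx p.1 * u ∉ pointIdeal K p ^ 2 := by
  obtain ⟨e, h1, h2⟩ := exists_dual2 hp
  intro h
  apply hu
  rw [← pow_one (pointIdeal K p), mem_pow_iff h1 h2, pow_one]
  rw [mem_pow_iff h1 h2, map_mul, tau_lx p e h1, pow_two, mul_assoc] at h
  have h := (mul_dvd_mul_iff_left Polynomial.X_ne_zero).1 h
  rcases Polynomial.prime_X.dvd_or_dvd h with h | h
  · rw [Polynomial.X_dvd_iff, Polynomial.coeff_C_zero] at h
    exact absurd h (lx_ne_zero hp.1)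
  · exact h

lemma pt_eval {p : (K × K) × (K × K)} {f : P4 K} (hf : f ∈ pointIdeal K p) :
    eval ![p.1.1, p.1.2, p.2.1, p.2.2] f = 0 := by
  have := pointIdeal_le_comap (eval ![p.1.1, p.1.2, p.2.1, p.2.2]) p ⊥ (f := f) (m := 1)
    (by simp [lx]; ring) (by simp [ly]; ring) (by simpa using hf)
  simpa using this

lemma pt_pderiv {p : (K × K) × (K × K)} {f : P4 K} (hf : f ∈ pointIdeal K p ^ 2) (i : Fin 4) :
    pderiv i f ∈ pointIdeal K p := by
  rw [pow_two] at hf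
  induction hf using Submodule.mul_induction_on' with
  | mem_mul_mem a ha b hb =>
    rw [Derivation.leibniz, smul_eq_mul, smul_eq_mul]
    exact Ideal.add_mem _ (Ideal.mul_mem_right _ _ ha) (Ideal.mul_mem_right _ _ hb)
  | add x _ y _ hx hy => rw [map_add]; exact Ideal.add_mem _ hx hy

lemma pt_homog (p : (K × K) × (K × K)) (m : ℕ) {f : P4 K} (hf : f ∈ pointIdeal K p ^ m)
    (d : ℕ × ℕ) : weightedHomogeneousComponent w4 d f ∈ pointIdeal K p ^ m := by
  let _ := weightedGradedAlgebra K w4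
  refine weightedHomogeneousComponent_mem_of_mem K w4 ?_ hf d
  have h1 : (pointIdeal K p).IsHomogeneous (weightedHomogeneousSubmodule K w4) := by
    rw [pointIdeal_eq]
    refine Ideal.homogeneous_span _ _ ?_
    rintro x (rfl | rfl)
    · exact ⟨_, wh_lx _⟩
    · exact ⟨_, wh_ly _⟩
  induction m with
  | zero => rw [pow_zero, Ideal.one_eq_top]; exact Ideal.IsHomogeneous.top _
  | succ m ih =>
    rw [pow_succ]
    refine Ideal.IsHomogeneous.mul ?_ h1
    by_cases hm : f ∈ pointIdeal K p ^ m
    · exact ih hm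
    · exact absurd (Ideal.pow_le_pow_right (Nat.le_succ m) hf) hm

/-- binary quadratic form in `x0, x1`. -/
def qd (s : K × K × K) : P4 K := C s.1 * X 0 ^ 2 + C s.2.1 * (X 0 * X 1) + C s.2.2 * X 1 ^ 2

/-- value of a binary quadratic form. -/
def qv (s : K × K × K) (a : K × K) : K := s.1 * a.1 ^ 2 + s.2.1 * (a.1 * a.2) + s.2.2 * a.2 ^ 2

/-- resultant of two binary quadratic forms. -/
def res (s t : K × K × K) : K := (s.1 * t.2.2 - t.1 * s.2.2) ^ 2
  - (s.1 * t.2.1 - t.1 * s.2.1) * (s.2.1 * t.2.2 - t.2.1 * s.2.2)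

/-- The curve of bidegree (2,1). -/
def Fc (s t : K × K × K) : P4 K := qd s * X 2 + qd t * X 3

/-- Restriction to the curve. -/
def phi (s t : K × K × K) : P4 K →ₐ[K] P4 K := aeval ![X 0, X 1, qd t, - qd s]

lemma wh_qd (s : K × K × K) : (qd s).IsWeightedHomogeneous w4 (2, 0) :=
  ((((wh_X 0).pow 2).C_mul _).add (((wh_X 0).mul (wh_X 1)).C_mul _)).add (((wh_X 1).pow 2).C_mul _)

lemma quad_factor (s : K × K × K) (a : K × K) (ha : a ≠ 0) (h : qv s a = 0) :
    ∃ α β : K, a.2 * α = s.1 ∧ a.2 * β - a.1 * α = s.2.1 ∧ -a.1 * β = s.2.2 := by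
  unfold qv at h
  by_cases h2 : a.2 = 0
  · have h1 : a.1 ≠ 0 := fun h1 => ha (Prod.ext h1 h2)
    simp only [h2] at h
    have hs : s.1 = 0 := by
      have : s.1 * a.1 ^ 2 = 0 := by linear_combination h
      simpa [h1] using this
    refine ⟨-s.2.1 / a.1, -s.2.2 / a.1, ?_, ?_, ?_⟩
    · rw [h2, hs]; ring
    · rw [h2]; field_simp; ring
    · field_simp
  · refine ⟨s.1 / a.2, (s.2.1 + a.1 * (s.1 / a.2)) / a.2, ?_, ?_, ?_⟩
    · field_simp
    · field_simp; ring
    · field_simp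
      linear_combination -h

lemma lx_dvd_qd (s : K × K × K) (a : K × K) (ha : a ≠ 0) (h : qv s a = 0) : lx a ∣ qd s := by
  obtain ⟨α, β, h1, h2, h3⟩ := quad_factor s a ha h
  refine ⟨C α * X 0 + C β * X 1, ?_⟩
  rw [qd, lx, ← h1, ← h2, ← h3]
  simp only [map_mul, map_sub, map_neg]
  ring

lemma cubic_aux {ρ a0 a1 b0 b1 : K} (hρ : ρ ≠ 0) {M qs qt : P4 K}
    (h : C ρ * M = (C a0 * X 0 + C a1 * X 1) * qt - (C b0 * X 0 + C b1 * X 1) * qs) :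
    ∃ a0 a1 b0 b1 : K, M = (C a0 * X 0 + C a1 * X 1) * qt - (C b0 * X 0 + C b1 * X 1) * qs := by
  refine ⟨ρ⁻¹ * a0, ρ⁻¹ * a1, ρ⁻¹ * b0, ρ⁻¹ * b1, ?_⟩
  have h1 : (C ρ⁻¹ * C ρ : P4 K) = 1 := by rw [← C_mul, inv_mul_cancel₀ hρ, C_1]
  simp only [map_mul]
  linear_combination C ρ⁻¹ * h - M * h1

lemma cubic {s t : K × K × K} (hρ : res s t ≠ 0) (i j : ℕ) (hij : i + j = 3) :
    ∃ a0 a1 b0 b1 : K, (X 0 ^ i * X 1 ^ j : P4 K) =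
      (C a0 * X 0 + C a1 * X 1) * qd t - (C b0 * X 0 + C b1 * X 1) * qd s := by
  obtain ⟨A0, B0, C0⟩ := s
  obtain ⟨A1, B1, C1⟩ := t
  have hi : i = 0 ∨ i = 1 ∨ i = 2 ∨ i = 3 := by omega
  set p := A0 * B1 - A1 * B0 with hp
  set q := A0 * C1 - A1 * C0 with hq
  set r := B0 * C1 - B1 * C0 with hr
  rcases hi with rfl | rfl | rfl | rfl
  · obtain rfl : j = 3 := by omega
    -- q x1U - p x1W - p x0U
    refine cubic_aux hρ (a0 := -p * A0) (a1 := q * A0 - p * B0) (b0 := -p * A1)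
      (b1 := q * A1 - p * B1) ?_
    simp only [hp, hq, hr, qd, res, map_mul, map_add, map_sub, map_neg, map_pow]
    ring
  · obtain rfl : j = 2 := by omega
    refine cubic_aux hρ (a0 := q * A0) (a1 := p * C0) (b0 := q * A1)
      (b1 := p * C1) ?_
    simp only [hp, hq, hr, qd, res, map_mul, map_add, map_sub, map_neg, map_pow]
    ring
  · obtain rfl : j = 1 := by omega
    refine cubic_aux hρ (a0 := -r * A0) (a1 := -q * C0) (b0 := -r * A1)
      (b1 := -q * C1) ?_
    simp only [hp, hq, hr, qd, res, map_mul, map_add, map_sub, map_neg, map_pow]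
    ring
  · obtain rfl : j = 0 := by omega
    refine cubic_aux hρ (a0 := -q * C0 + r * B0) (a1 := r * C0) (b0 := -q * C1 + r * B1)
      (b1 := r * C1) ?_
    simp only [hp, hq, hr, qd, res, map_mul, map_add, map_sub, map_neg, map_pow]
    ring

lemma phi_C (s t : K × K × K) (c : K) : phi s t (C c) = C c := by rw [phi, aeval_C]; rfl
lemma phi_X0 (s t : K × K × K) : phi s t (X 0) = X 0 := by rw [phi, aeval_X]; rfl
lemma phi_X1 (s t : K × K × K) : phi s t (X 1) = X 1 := by rw [phi, aeval_X]; rfl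
lemma phi_X2 (s t : K × K × K) : phi s t (X 2) = qd t := by rw [phi, aeval_X]; rfl
lemma phi_X3 (s t : K × K × K) : phi s t (X 3) = - qd s := by rw [phi, aeval_X]; rfl

lemma phi_surj_mono {s t : K × K × K} (hρ : res s t ≠ 0) {a : ℕ} (ha : 1 ≤ a) (r : ℕ) :
    ∀ i j : ℕ, i + j = a + 2 * r →
    ∃ g : P4 K, g.IsWeightedHomogeneous w4 (a, r) ∧ phi s t g = X 0 ^ i * X 1 ^ j := by
  induction r with
  | zero =>
    intro i j hij
    refine ⟨X 0 ^ i * X 1 ^ j, ?_, by rw [map_mul, map_pow, map_pow, phi_X0, phi_X1]⟩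
    have := ((wh_X (K := K) 0).pow i).mul ((wh_X 1).pow j)
    convert this using 1
    ext <;> simp [w4]; omega
  | succ r ih =>
    intro i j hij
    obtain ⟨i1, j1, i2, j2, h3, h4, h5⟩ : ∃ i1 j1 i2 j2 : ℕ, i1 + j1 = 3 ∧ i = i1 + i2 ∧
        j = j1 + j2 := by
      by_cases hi : 3 ≤ i
      · exact ⟨3, 0, i - 3, j, rfl, by omega, by omega⟩
      · exact ⟨i, 3 - i, 0, j - (3 - i), by omega, by omega, by omega⟩
    obtain ⟨a0, a1, b0, b1, hM⟩ := cubic hρ i1 j1 h3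
    obtain ⟨g1, hg1, e1⟩ := ih (i2 + 1) j2 (by omega)
    obtain ⟨g2, hg2, e2⟩ := ih i2 (j2 + 1) (by omega)
    refine ⟨X 2 * (C a0 * g1 + C a1 * g2) + X 3 * (C b0 * g1 + C b1 * g2), ?_, ?_⟩
    · have hx : (a, r + 1) = ((0, 1) : ℕ × ℕ) + (a, r) := by ext <;> simp; omega
      rw [hx]
      exact ((wh_X 2).mul ((hg1.C_mul _).add (hg2.C_mul _))).add
        ((wh_X 3).mul ((hg1.C_mul _).add (hg2.C_mul _)))
    · simp only [map_add, map_mul, phi_C, phi_X2, phi_X3, e1, e2]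
      rw [h4, h5]
      linear_combination -(X 0 ^ i2 * X 1 ^ j2) * hM

lemma phi_surj {s t : K × K × K} (hρ : res s t ≠ 0) {a r : ℕ} (ha : 1 ≤ a) {h : P4 K}
    (hh : h.IsWeightedHomogeneous w4 (a + 2 * r, 0)) :
    ∃ g : P4 K, g.IsWeightedHomogeneous w4 (a, r) ∧ phi s t g = h := by
  induction hh using IsWeightedHomogeneous.induction_on with
  | zero => exact ⟨0, isWeightedHomogeneous_zero K w4 _, map_zero _⟩
  | add p q _ _ hp hq =>
    obtain ⟨g1, hg1, rfl⟩ := hp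
    obtain ⟨g2, hg2, rfl⟩ := hq
    exact ⟨g1 + g2, hg1.add hg2, map_add _ _ _⟩
  | monomial e c he =>
    rw [weight_w4, Prod.mk.injEq] at he
    obtain ⟨g, hg, e1⟩ := phi_surj_mono hρ ha r (e 0) (e 1) he.1
    refine ⟨C c * g, hg.C_mul c, ?_⟩
    rw [map_mul, phi_C, e1, monomial_eq, Finsupp.prod_fintype _ _ (by simp), Fin.prod_univ_four]
    have h2 : e 2 = 0 := by omega
    have h3 : e 3 = 0 := by omega
    simp [h2, h3]

lemma phi_fix {s t : K × K × K} {c : ℕ} {h : P4 K}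
    (hh : h.IsWeightedHomogeneous w4 (c, 0)) : phi s t h = h := by
  induction hh using IsWeightedHomogeneous.induction_on with
  | zero => exact map_zero _
  | add p q _ _ hp hq => rw [map_add, hp, hq]
  | monomial e c he =>
    rw [weight_w4, Prod.mk.injEq] at he
    have h2 : e 2 = 0 := by omega
    have h3 : e 3 = 0 := by omega
    rw [monomial_eq, Finsupp.prod_fintype _ _ (by simp), Fin.prod_univ_four]
    simp [h2, h3, phi_C, phi_X0, phi_X1]

lemma dvd_aeval_sub (F : P4 K) (u v : Fin 4 → P4 K) (h : ∀ i, F ∣ u i - v i) (f : P4 K) :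
    F ∣ aeval u f - aeval v f := by
  induction f using MvPolynomial.induction_on with
  | C c => rw [aeval_C, aeval_C, sub_self]; exact dvd_zero _
  | add p q hp hq =>
    rw [map_add, map_add, add_sub_add_comm]; exact dvd_add hp hq
  | mul_X f i hf =>
    rw [map_mul, map_mul, aeval_X, aeval_X]
    have : aeval u f * u i - aeval v f * v i
      = (aeval u f - aeval v f) * u i + aeval v f * (u i - v i) := by ring
    rw [this]
    exact dvd_add (hf.mul_right _) ((h i).mul_left _)

lemma aeval_id4 (f : P4 K) : aeval ![X 0, X 1, X 2, X 3] f = f := by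
  have : (![X 0, X 1, X 2, X 3] : Fin 4 → P4 K) = X := by
    ext i; fin_cases i <;> rfl
  rw [this, aeval_X_left_apply]

lemma Fc_dvd1 (s t : K × K × K) {a b : ℕ} {f : P4 K} (hf : f.IsWeightedHomogeneous w4 (a, b)) :
    Fc s t ∣ qd s ^ b * f - (- X 3) ^ b * phi s t f := by
  have h := dvd_aeval_sub (Fc s t) ![X 0, X 1, qd s * X 2, qd s * X 3]
    ![X 0, X 1, (- X 3) * qd t, (- X 3) * (- qd s)] ?_ f
  · rwa [aeval_scale _ _ _ _ _ hf, aeval_scale _ _ _ _ _ hf, aeval_id4] at h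
  · intro i
    fin_cases i
    · simp
    · simp
    · exact ⟨1, by simp [Fc]; ring⟩
    · exact ⟨0, by simp; ring⟩

lemma Fc_dvd2 (s t : K × K × K) {a b : ℕ} {f : P4 K} (hf : f.IsWeightedHomogeneous w4 (a, b)) :
    Fc s t ∣ qd t ^ b * f - (X 2) ^ b * phi s t f := by
  have h := dvd_aeval_sub (Fc s t) ![X 0, X 1, qd t * X 2, qd t * X 3]
    ![X 0, X 1, (X 2) * qd t, (X 2) * (- qd s)] ?_ f
  · rwa [aeval_scale _ _ _ _ _ hf, aeval_scale _ _ _ _ _ hf, aeval_id4] at h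
  · intro i
    fin_cases i
    · simp
    · simp
    · exact ⟨0, by simp; ring⟩
    · exact ⟨1, by simp [Fc]; ring⟩

lemma relPrime_X : IsRelPrime (X 0 : P4 K) (X 1) := by
  intro d h0 h1
  have hi : Irreducible (X 0 : P4 K) := X_prime.irreducible
  by_contra hd
  have h2 : X 0 ∣ d := by
    obtain ⟨c, hc⟩ := h0
    rcases hi.isUnit_or_isUnit hc with h | h
    · exact absurd h hd
    · obtain ⟨u, rfl⟩ := h
      exact ⟨↑u⁻¹, by rw [hc, mul_assoc, Units.mul_inv, mul_one]⟩
  obtain ⟨c, hc⟩ := h2.trans h1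
  have := congrArg (eval ![(0 : K), 1, 0, 0]) hc
  simp at this

lemma dvd_qd_unit {s t : K × K × K} (hρ : res s t ≠ 0) : IsRelPrime (qd s) (qd t) := by
  intro d h0 h1
  have key : ∀ i j : ℕ, i + j = 3 → d ∣ (X 0 ^ i * X 1 ^ j : P4 K) := by
    intro i j hij
    obtain ⟨a0, a1, b0, b1, hM⟩ := cubic hρ i j hij
    rw [hM]
    exact dvd_sub (h1.mul_left _) (h0.mul_left _)
  have k1 := key 3 0 rfl
  have k2 := key 0 3 rfl
  simp only [pow_zero, one_mul, mul_one] at k1 k2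
  exact (relPrime_X.pow (m := 3) (n := 3)) k1 k2

lemma ker_phi {s t : K × K × K} (hρ : res s t ≠ 0) {a b : ℕ} {f : P4 K}
    (hf : f.IsWeightedHomogeneous w4 (a, b)) (h0 : phi s t f = 0) : Fc s t ∣ f := by
  classical
  have h1 := Fc_dvd1 s t hf
  have h2 := Fc_dvd2 s t hf
  rw [h0, mul_zero, sub_zero] at h1 h2
  have hrel : IsRelPrime (qd s ^ b) (qd t ^ b) := (dvd_qd_unit hρ).pow
  let _ : GCDMonoid (P4 K) := UniqueFactorizationMonoid.toGCDMonoid _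
  have h3 := dvd_gcd h1 h2
  have h4 := h3.trans (gcd_mul_right' f (qd s ^ b) (qd t ^ b)).dvd
  have hu : IsUnit (gcd (qd s ^ b) (qd t ^ b)) := hrel (gcd_dvd_left _ _) (gcd_dvd_right _ _)
  exact (hu.dvd_mul_left).1 h4

lemma wh_phi (s t : K × K × K) {a b : ℕ} {f : P4 K} (hf : f.IsWeightedHomogeneous w4 (a, b)) :
    (phi s t f).IsWeightedHomogeneous w4 (a + 2 * b, 0) := by
  let ψ : ℕ × ℕ →+ ℕ × ℕ :=
    { toFun := fun d => (d.1 + 2 * d.2, 0)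
      map_zero' := rfl
      map_add' := fun x y => by ext <;> simp; ring }
  refine wh_aeval ψ _ ?_ hf
  intro i
  fin_cases i
  · exact wh_X 0
  · exact wh_X 1
  · exact wh_qd t
  · exact (wh_qd s).neg

/-- Concrete form of the hypotheses used by the reduction step. -/
def Good (Z : Fin 5 → (K × K) × (K × K)) (s t : K × K × K) : Prop :=
  (∀ i, IsPtRep K (Z i)) ∧ (∀ i j, i ≠ j → ¬ ProjEq K (Z i).1 (Z j).1) ∧ res s t ≠ 0 ∧
  ∀ i, qv s (Z i).1 * (Z i).2.1 + qv t (Z i).1 * (Z i).2.2 = 0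

section step
variable {Z : Fin 5 → (K × K) × (K × K)} {s t : K × K × K}

lemma good_dvd (hG : Good Z s t) (i : Fin 5) :
    lx (Z i).1 ∣ C (Z i).2.1 * qd s + C (Z i).2.2 * qd t := by
  have h := lx_dvd_qd ((Z i).2.1 * s.1 + (Z i).2.2 * t.1, (Z i).2.1 * s.2.1 + (Z i).2.2 * t.2.1,
    (Z i).2.1 * s.2.2 + (Z i).2.2 * t.2.2) (Z i).1 (hG.1 i).1
    (by have := hG.2.2.2 i; unfold qv at this ⊢; linear_combination this)
  convert h using 1
  simp only [qd, map_add, map_mul]; ring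

lemma good_phi_dvd (hG : Good Z s t) (i : Fin 5) {n : ℕ} {f : P4 K}
    (hf : f ∈ pointIdeal K (Z i) ^ n) : lx (Z i).1 ^ n ∣ phi s t f := by
  rw [← Ideal.mem_span_singleton, ← Ideal.span_singleton_pow]
  refine pointIdeal_le_comap (phi s t).toRingHom (Z i) _ ?_ ?_ hf
  · rw [Ideal.mem_span_singleton]
    show _ ∣ phi s t (lx (Z i).1)
    rw [phi_fix (wh_lx _)]
  · rw [Ideal.mem_span_singleton]
    show _ ∣ phi s t (ly (Z i).2)
    rw [ly, map_sub, map_mul, map_mul, phi_C, phi_C, phi_X2, phi_X3]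
    convert good_dvd hG i using 1
    ring

lemma mem_of_C_mul {I : Ideal (P4 K)} {c : K} (hc : c ≠ 0) {f : P4 K} (h : C c * f ∈ I) : f ∈ I := by
  have h1 : (C c⁻¹ * C c : P4 K) = 1 := by rw [← C_mul, inv_mul_cancel₀ hc, C_1]
  have := I.mul_mem_left (C c⁻¹) h
  rwa [← mul_assoc, h1, one_mul] at this

lemma Fc_mem (hG : Good Z s t) (i : Fin 5) : Fc s t ∈ pointIdeal K (Z i) := by
  have h1 : C (Z i).2.1 * qd s + C (Z i).2.2 * qd t ∈ pointIdeal K (Z i) := by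
    obtain ⟨c, hc⟩ := good_dvd hG i
    rw [hc]; exact Ideal.mul_mem_right _ _ (lx_mem _)
  have h2 := ly_mem (Z i)
  by_cases hb : (Z i).2.1 = 0
  · have hb' : (Z i).2.2 ≠ 0 := fun h => (hG.1 i).2 (Prod.ext hb h)
    refine mem_of_C_mul hb' ?_
    have : C (Z i).2.2 * Fc s t = qd s * ly (Z i).2
      + X 3 * (C (Z i).2.1 * qd s + C (Z i).2.2 * qd t) := by
      rw [Fc, ly]; ring
    rw [this]
    exact Ideal.add_mem _ (Ideal.mul_mem_left _ _ h2) (Ideal.mul_mem_left _ _ h1)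
  · refine mem_of_C_mul hb ?_
    have : C (Z i).2.1 * Fc s t = -qd t * ly (Z i).2
      + X 2 * (C (Z i).2.1 * qd s + C (Z i).2.2 * qd t) := by
      rw [Fc, ly]; ring
    rw [this]
    exact Ideal.add_mem _ (Ideal.mul_mem_left _ _ h2) (Ideal.mul_mem_left _ _ h1)

lemma not_both (hG : Good Z s t) (i : Fin 5) (h0 : qd s ∈ pointIdeal K (Z i))
    (h1 : qd t ∈ pointIdeal K (Z i)) : False := by
  have key : ∀ a b : ℕ, a + b = 3 → (X 0 ^ a * X 1 ^ b : P4 K) ∈ pointIdeal K (Z i) := by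
    intro a b hab
    obtain ⟨a0, a1, b0, b1, hM⟩ := cubic hG.2.2.1 a b hab
    rw [hM]
    exact Ideal.sub_mem _ (Ideal.mul_mem_left _ _ h1) (Ideal.mul_mem_left _ _ h0)
  have k1 := pt_eval (key 3 0 rfl)
  have k2 := pt_eval (key 0 3 rfl)
  simp at k1 k2
  exact (hG.1 i).1 (Prod.ext k1 k2)

lemma pderiv_qd (s : K × K × K) : pderiv 2 (qd s) = 0 ∧ pderiv 3 (qd s) = 0 := by
  constructor <;> simp [qd, pderiv_X]

lemma Fc_not_mem (hG : Good Z s t) (i : Fin 5) : Fc s t ∉ pointIdeal K (Z i) ^ 2 := by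
  intro h
  have h2 := pt_pderiv h 2
  have h3 := pt_pderiv h 3
  rw [Fc, map_add, Derivation.leibniz, Derivation.leibniz] at h2 h3
  simp [pderiv_qd, pderiv_X] at h2 h3
  exact not_both hG i h2 h3

lemma mem_of_phi_mem (hG : Good Z s t) (i : Fin 5) {a r : ℕ} {f : P4 K}
    (hf : f.IsWeightedHomogeneous w4 (a, r)) (h : phi s t f ∈ pointIdeal K (Z i)) :
    f ∈ pointIdeal K (Z i) := by
  have aux : ∀ u v q : P4 K, Fc s t ∣ q - v * phi s t f → q ∈ pointIdeal K (Z i) := by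
    intro u v q hd
    obtain ⟨c, hc⟩ := hd
    have : q = Fc s t * c + v * phi s t f := by rw [← hc]; ring
    rw [this]
    exact Ideal.add_mem _ (Ideal.mul_mem_right _ _ (Fc_mem hG i)) (Ideal.mul_mem_left _ _ h)
  rcases pt_prime_pow (hG.1 i) (aux 0 _ _ (Fc_dvd1 s t hf)) with h1 | h1
  · rcases pt_prime_pow (hG.1 i) (aux 0 _ _ (Fc_dvd2 s t hf)) with h2 | h2
    · exact (not_both hG i h1 h2).elim
    · exact h2
  · exact h1

/-- product of the five linear forms. -/
def Lp (Z : Fin 5 → (K × K) × (K × K)) : P4 K := ∏ i, lx (Z i).1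

lemma wh_Lp (Z : Fin 5 → (K × K) × (K × K)) : (Lp Z).IsWeightedHomogeneous w4 (5, 0) := by
  have := IsWeightedHomogeneous.prod Finset.univ (fun i => lx (Z i).1) (fun _ => ((1, 0) : ℕ × ℕ))
      (w := w4) (fun i _ => wh_lx _)
  simpa [Lp] using this

lemma Lp_mem (Z : Fin 5 → (K × K) × (K × K)) (i : Fin 5) : Lp Z ∈ pointIdeal K (Z i) :=
  Ideal.mem_of_dvd _ (Finset.dvd_prod_of_mem (fun i => lx (Z i).1) (Finset.mem_univ i)) (lx_mem _)

lemma Lp_not_mem (hG : Good Z s t) (i : Fin 5) : Lp Z ∉ pointIdeal K (Z i) ^ 2 := by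
  rw [Lp, ← Finset.mul_prod_erase _ _ (Finset.mem_univ i)]
  refine lx_mul_not_mem (hG.1 i) fun h => ?_
  have h := pt_eval h
  rw [map_prod, Finset.prod_eq_zero_iff] at h
  obtain ⟨j, hj, h⟩ := h
  refine hG.2.1 i j (Finset.ne_of_mem_erase hj).symm ?_
  simp [lx] at h
  unfold ProjEq
  linear_combination h

lemma relPrime_lx {a b : K × K} (h : ¬ ProjEq K a b) : IsRelPrime (lx a) (lx b) := by
  intro d ha hb
  have hδ : a.2 * b.1 - a.1 * b.2 ≠ 0 := fun h' => h (by unfold ProjEq; linear_combination -h')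
  have hu : IsUnit (C (a.2 * b.1 - a.1 * b.2) : P4 K) := (isUnit_iff_ne_zero.2 hδ).map C
  refine relPrime_X (K := K) ?_ ?_
  · rw [← hu.dvd_mul_left]
    have : C (a.2 * b.1 - a.1 * b.2) * X 0 = C b.1 * lx a - C a.1 * lx b := by
      simp only [lx, map_sub, map_mul]; ring
    rw [this]
    exact dvd_sub (ha.mul_left _) (hb.mul_left _)
  · rw [← hu.dvd_mul_left]
    have : C (a.2 * b.1 - a.1 * b.2) * X 1 = C b.2 * lx a - C a.2 * lx b := by
      simp only [lx, map_sub, map_mul]; ring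
    rw [this]
    exact dvd_sub (ha.mul_left _) (hb.mul_left _)

lemma Lp_pow_dvd (hG : Good Z s t) {n : ℕ} {f : P4 K} (h : ∀ i, lx (Z i).1 ^ n ∣ f) :
    Lp Z ^ n ∣ f := by
  rw [Lp, ← Finset.prod_pow]
  refine Fintype.prod_dvd_of_isRelPrime ?_ h
  intro i j hij
  exact (relPrime_lx (hG.2.1 i j hij)).pow

lemma lx_dvd_of_small {p : (K × K) × (K × K)} (hp : IsPtRep K p) {a b n : ℕ} (hbn : b < n)
    {f : P4 K} (hf : f.IsWeightedHomogeneous w4 (a, b)) (h : f ∈ pointIdeal K p ^ n) :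
    lx p.1 ∣ f := by
  obtain ⟨e, he, -⟩ := exists_dual2 hp
  set u : Fin 4 → P4 K := ![X 0 - C e.1.1 * lx p.1, X 1 - C e.1.2 * lx p.1, X 2, X 3] with hu
  have h1 : lx p.1 ∣ f - aeval u f := by
    have := dvd_aeval_sub (lx p.1) ![X 0, X 1, X 2, X 3] u ?_ f
    · rwa [aeval_id4] at this
    · intro i
      fin_cases i <;> simp [hu]
  have hw : (aeval u f).IsWeightedHomogeneous w4 (a, b) := by
    refine wh_aeval (AddMonoidHom.id _) u ?_ hf
    intro i
    fin_cases i
    · exact (wh_X 0).sub ((wh_lx _).C_mul _)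
    · exact (wh_X 1).sub ((wh_lx _).C_mul _)
    · exact wh_X 2
    · exact wh_X 3
  have hC : ∀ c : K, aeval u (C c : P4 K) = C c := fun c => by rw [aeval_C]; rfl
  have h2 : (aeval u).toRingHom f ∈ (Ideal.span {ly p.2}) ^ n := by
    refine pointIdeal_le_comap (aeval u).toRingHom p _ ?_ ?_ h
    · have : (aeval u).toRingHom (lx p.1) = 0 := by
        show aeval u (lx p.1) = 0
        have h1 : (C p.1.2 * C e.1.1 - C p.1.1 * C e.1.2 : P4 K) = 1 := by
          rw [← C_mul, ← C_mul, ← C_sub, he, C_1]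
        have h4 : aeval u (lx p.1) = C p.1.2 * (X 0 - C e.1.1 * lx p.1)
            - C p.1.1 * (X 1 - C e.1.2 * lx p.1) := by
          conv_lhs => arg 2; rw [lx]
          rw [map_sub, map_mul, map_mul, hC, hC, aeval_X, aeval_X]; rfl
        have h5 : lx p.1 = C p.1.2 * X 0 - C p.1.1 * X 1 := rfl
        rw [h4]
        linear_combination -lx p.1 * h1 - h5
      rw [this]; exact Ideal.zero_mem _
    · have : (aeval u).toRingHom (ly p.2) = ly p.2 := by
        show aeval u (ly p.2) = ly p.2
        rw [ly, map_sub, map_mul, map_mul, hC, hC, aeval_X, aeval_X]; rfl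
      rw [this]; exact Ideal.mem_span_singleton_self _
  rw [Ideal.span_singleton_pow, Ideal.mem_span_singleton] at h2
  obtain ⟨v, hv⟩ := h2
  have h3 : aeval u f = 0 := by
    rcases wh_cofactor hw ((wh_ly p.2).pow n) hv with h | h
    · exact h.2
    · have := h.1.2
      simp at this
      omega
  rwa [h3, sub_zero] at h1

lemma mem_ideal_iff {f : P4 K} : f ∈ idealOfPoints K Z ↔ ∀ i, f ∈ pointIdeal K (Z i) := by
  rw [idealOfPoints, Ideal.mem_iInf]

lemma mem_symb_iff {f : P4 K} {m : ℕ} :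
    f ∈ symbolicPower K Z m ↔ ∀ i, f ∈ pointIdeal K (Z i) ^ m := by
  rw [symbolicPower, Ideal.mem_iInf]

lemma ideal_pow_le (m : ℕ) : idealOfPoints K Z ^ m ≤ symbolicPower K Z m := by
  rw [symbolicPower]
  exact le_iInf fun i => Ideal.pow_right_mono (iInf_le _ i) m

lemma exists_gen (hG : Good Z s t) {a r : ℕ} (ha : 1 ≤ a) (h : a + 2 * r = 5) :
    ∃ g : P4 K, g.IsWeightedHomogeneous w4 (a, r) ∧ phi s t g = Lp Z ∧ g ∈ idealOfPoints K Z := by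
  obtain ⟨g, hg, e⟩ := phi_surj hG.2.2.1 ha (h := Lp Z) (r := r) (by rw [h]; exact wh_Lp Z)
  refine ⟨g, hg, e, mem_ideal_iff.2 fun i => mem_of_phi_mem hG i hg ?_⟩
  rw [e]; exact Lp_mem Z i

/-- The key reduction step. -/
lemma step (hG : Good Z s t) {m : ℕ} (ih : symbolicPower K Z m ≤ idealOfPoints K Z ^ m)
    {a b : ℕ} (hab : b ≤ a) {f : P4 K} (hf : f.IsWeightedHomogeneous w4 (a, b))
    (hm : f ∈ symbolicPower K Z (m + 1)) : f ∈ idealOfPoints K Z ^ (m + 1) := by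
  rw [mem_symb_iff] at hm
  by_cases hb : b < m + 1
  · obtain ⟨v, rfl⟩ : Lp Z ∣ f := by
      have := Lp_pow_dvd hG (n := 1) (f := f) fun i => by
        rw [pow_one]; exact lx_dvd_of_small (hG.1 i) hb hf (hm i)
      rwa [pow_one] at this
    rw [pow_succ']
    refine Ideal.mul_mem_mul (mem_ideal_iff.2 fun i => Lp_mem Z i) (ih (mem_symb_iff.2 fun i => ?_))
    exact pt_cancel (hG.1 i) (Lp_not_mem hG i) (hm i)
  · -- it suffices to find `g`
    suffices hg : ∃ g : P4 K, g.IsWeightedHomogeneous w4 (a, b) ∧ phi s t g = phi s t f ∧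
        g ∈ idealOfPoints K Z ^ (m + 1) by
      obtain ⟨g, hg, e, hgI⟩ := hg
      obtain ⟨v, hv⟩ := ker_phi hG.2.2.1 (hf.sub hg) (by rw [map_sub, e, sub_self])
      have hgs := mem_symb_iff.1 (ideal_pow_le (m + 1) hgI)
      have : f = g + Fc s t * v := by rw [← hv]; ring
      rw [this]
      refine Ideal.add_mem _ hgI ?_
      rw [pow_succ']
      refine Ideal.mul_mem_mul (mem_ideal_iff.2 fun i => Fc_mem hG i)
        (ih (mem_symb_iff.2 fun i => ?_))
      refine pt_cancel (hG.1 i) (Fc_not_mem hG i) ?_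
      rw [← hv]
      exact Ideal.sub_mem _ (hm i) (hgs i)
    set n := m + 1 with hn
    obtain ⟨v, hv⟩ := Lp_pow_dvd hG fun i => good_phi_dvd hG i (hm i)
    rcases wh_cofactor (wh_phi s t hf) ((wh_Lp Z).pow n) hv with h | ⟨hle, h, hh, hfh⟩
    · exact ⟨0, isWeightedHomogeneous_zero K w4 _, by rw [h.2, map_zero], Ideal.zero_mem _⟩
    have hle' : n * 5 ≤ a + 2 * b := by simpa using hle.1
    have hdeg : ((a + 2 * b, 0) - n • (5, 0) : ℕ × ℕ) = (a + 2 * b - n * 5, 0) := by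
      ext <;> simp
    rw [hdeg] at hh
    obtain ⟨g12, hg12, e12, m12⟩ := exists_gen hG (a := 1) (r := 2) le_rfl rfl
    by_cases hb2 : b ≤ 2 * n
    · obtain ⟨g31, hg31, e31, m31⟩ := exists_gen hG (a := 3) (r := 1) (by norm_num) rfl
      have hpq : (2 * n - b) + (b - n) = n := by omega
      refine ⟨g31 ^ (2 * n - b) * g12 ^ (b - n) * h, ?_, ?_, ?_⟩
      · have := ((hg31.pow (2 * n - b)).mul (hg12.pow (b - n))).mul hh
        convert this using 1
        ext <;> simp <;> omega
      · rw [map_mul, map_mul, map_pow, map_pow, e12, e31, phi_fix hh, hfh, ← pow_add, hpq]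
      · refine Ideal.mul_mem_right _ _ ?_
        rw [← hpq, pow_add, hpq]
        exact Ideal.mul_mem_mul (Ideal.pow_mem_pow m31 _) (Ideal.pow_mem_pow m12 _)
    · obtain ⟨g, hg, e⟩ := phi_surj hG.2.2.1 (a := a - n) (r := b - 2 * n) (by omega) (h := h)
        (by convert hh using 2; omega)
      refine ⟨g12 ^ n * g, ?_, ?_, ?_⟩
      · have := (hg12.pow n).mul hg
        convert this using 1
        ext <;> simp <;> omega
      · rw [map_mul, map_pow, e12, e, hfh]
      · exact Ideal.mul_mem_right _ _ (Ideal.pow_mem_pow m12 _)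

end step


lemma finite_wh (d : ℕ × ℕ) : Module.Finite K (weightedHomogeneousSubmodule K w4 d) := by
  have hfin : Finite {e : Fin 4 →₀ ℕ | Finsupp.weight w4 e = d} := by
    refine Set.Finite.subset
      (Set.finite_Iic (Finsupp.equivFunOnFinite.symm fun _ : Fin 4 => d.1 + d.2)) ?_
    intro e he
    rw [Set.mem_ofPred_eq, weight_w4] at he
    rw [Set.mem_Iic]
    intro i
    rw [← he]
    fin_cases i <;> simp <;> omega
  rw [weightedHomogeneousSubmodule_eq_finsupp_supported]
  exact Module.Finite.of_basis (basisRestrictSupport K {e | Finsupp.weight w4 e = d})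

lemma no_elem {Z : Fin 5 → (K × K) × (K × K)} (hZ : Mult1Generic K Z) (S : Finset (Fin 5))
    (i j : ℕ) (hS : (i + 1) * (j + 1) ≤ S.card) {f : P4 K}
    (hf : f.IsWeightedHomogeneous w4 (i, j)) (h : ∀ a ∈ S, f ∈ pointIdeal K (Z a)) : f = 0 := by
  have h1 := hZ.2.2 S i j
  rw [Nat.sub_eq_zero_of_le hS] at h1
  have hfin := finite_wh (K := K) (i, j)
  have hfin2 : Module.Finite K
      ↥(bipiece K (⨅ a ∈ S, pointIdeal K (Z a)) (i, j)) :=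
    Submodule.finiteDimensional_of_le (inf_le_right :
      bipiece K (⨅ a ∈ S, pointIdeal K (Z a)) (i, j) ≤ weightedHomogeneousSubmodule K w4 (i, j))
  rw [Submodule.finrank_eq_zero] at h1
  have h2 : f ∈ bipiece K (⨅ a ∈ S, pointIdeal K (Z a)) (i, j) := by
    refine ⟨?_, hf⟩
    change f ∈ (⨅ a ∈ S, pointIdeal K (Z a))
    simpa [Submodule.mem_iInf] using h
  rw [h1] at h2
  simpa using h2

/-- The bilinear form with given coefficients. -/
def bil (α0 β0 α1 β1 : K) : P4 K :=
  (C α0 * X 0 + C β0 * X 1) * X 2 + (C α1 * X 0 + C β1 * X 1) * X 3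

lemma wh_bil (α0 β0 α1 β1 : K) : (bil α0 β0 α1 β1).IsWeightedHomogeneous w4 (1, 1) :=
  ((((wh_X 0).C_mul _).add ((wh_X 1).C_mul _)).mul (wh_X 2)).add
    ((((wh_X 0).C_mul _).add ((wh_X 1).C_mul _)).mul (wh_X 3))

lemma bil_mem {p : (K × K) × (K × K)} (hp : IsPtRep K p) {α0 β0 α1 β1 : K}
    (h : (α0 * p.1.1 + β0 * p.1.2) * p.2.1 + (α1 * p.1.1 + β1 * p.1.2) * p.2.2 = 0) :
    bil α0 β0 α1 β1 ∈ pointIdeal K p := by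
  obtain ⟨e, he⟩ := exists_dual p.1 hp.1
  obtain ⟨f, hf⟩ := exists_dual p.2 hp.2
  have he' := congrArg (C (σ := Fin 4)) he
  have hf' := congrArg (C (σ := Fin 4)) hf
  have h' := congrArg (C (σ := Fin 4)) h
  simp only [map_add, map_sub, map_mul, map_one, map_zero] at he' hf' h'
  have h0 : (X 0 : P4 K) = C e.1 * lx p.1 + C p.1.1 * (C e.1 * X 1 - C e.2 * X 0) := by
    rw [lx]; linear_combination - X 0 * he'
  have h1 : (X 1 : P4 K) = C e.2 * lx p.1 + C p.1.2 * (C e.1 * X 1 - C e.2 * X 0) := by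
    rw [lx]; linear_combination - X 1 * he'
  have h2 : (X 2 : P4 K) = C f.1 * ly p.2 + C p.2.1 * (C f.1 * X 3 - C f.2 * X 2) := by
    rw [ly]; linear_combination - X 2 * hf'
  have h3 : (X 3 : P4 K) = C f.2 * ly p.2 + C p.2.2 * (C f.1 * X 3 - C f.2 * X 2) := by
    rw [ly]; linear_combination - X 3 * hf'
  generalize (C e.1 * X 1 - C e.2 * X 0 : P4 K) = u at h0 h1
  generalize (C f.1 * X 3 - C f.2 * X 2 : P4 K) = v at h2 h3
  have key : bil α0 β0 α1 β1 =
      ((C α0 * X 0 + C β0 * X 1) * C f.1 + (C α1 * X 0 + C β1 * X 1) * C f.2) * ly p.2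
      + v * ((C α0 * C e.1 + C β0 * C e.2) * C p.2.1 + (C α1 * C e.1 + C β1 * C e.2) * C p.2.2)
        * lx p.1 := by
    rw [bil]
    linear_combination (C α0 * X 0 + C β0 * X 1) * h2 + (C α1 * X 0 + C β1 * X 1) * h3
      + v * (C p.2.1 * C α0 + C p.2.2 * C α1) * h0 + v * (C p.2.1 * C β0 + C p.2.2 * C β1) * h1
      + u * v * h'
  rw [key]
  exact Ideal.add_mem _ (Ideal.mul_mem_left _ _ (ly_mem p)) (Ideal.mul_mem_left _ _ (lx_mem p))

lemma ly_ne_zero {a : K × K} (ha : a ≠ 0) : ly a ≠ 0 := by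
  obtain ⟨e, he⟩ := exists_dual a ha
  intro h
  have := congrArg (eval ![0, 0, e.1, e.2]) h
  simp [ly] at this
  rw [he] at this
  exact one_ne_zero this

/-- The consequences of genericity that are used in the proof. -/
def Base (Z : Fin 5 → (K × K) × (K × K)) : Prop :=
  (∀ i, IsPtRep K (Z i)) ∧ (∀ i j, i ≠ j → ¬ ProjEq K (Z i).1 (Z j).1) ∧
  (∀ i j, i ≠ j → ¬ ProjEq K (Z i).2 (Z j).2) ∧
  ∀ i0, ∀ α0 β0 α1 β1 : K, (∀ i, i ≠ i0 → (α0 * (Z i).1.1 + β0 * (Z i).1.2) * (Z i).2.1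
    + (α1 * (Z i).1.1 + β1 * (Z i).1.2) * (Z i).2.2 = 0) →
    α0 = 0 ∧ β0 = 0 ∧ α1 = 0 ∧ β1 = 0

lemma lx_mem_of_projEq {a : K × K} {p : (K × K) × (K × K)} (hp : IsPtRep K p)
    (h : ProjEq K a p.1) : lx a ∈ pointIdeal K p := by
  obtain ⟨e, he⟩ := exists_dual p.1 hp.1
  have : lx a = C (a.2 * e.1 - a.1 * e.2) * lx p.1 := by
    have he' := congrArg (C (σ := Fin 4)) he
    have h' := congrArg (C (σ := Fin 4)) (show a.1 * p.1.2 = a.2 * p.1.1 from h)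
    simp only [map_add, map_sub, map_mul, map_one, map_zero] at he' h' ⊢
    rw [lx, lx]
    linear_combination (-C a.2 * X 0 + C a.1 * X 1) * he' + (C e.2 * X 0 - C e.1 * X 1) * h'
  rw [this]
  exact Ideal.mul_mem_left _ _ (lx_mem p)

lemma ly_mem_of_projEq {a : K × K} {p : (K × K) × (K × K)} (hp : IsPtRep K p)
    (h : ProjEq K a p.2) : ly a ∈ pointIdeal K p := by
  obtain ⟨e, he⟩ := exists_dual p.2 hp.2
  have : ly a = C (a.2 * e.1 - a.1 * e.2) * ly p.2 := by
    have he' := congrArg (C (σ := Fin 4)) he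
    have h' := congrArg (C (σ := Fin 4)) (show a.1 * p.2.2 = a.2 * p.2.1 from h)
    simp only [map_add, map_sub, map_mul, map_one, map_zero] at he' h' ⊢
    rw [ly, ly]
    linear_combination (-C a.2 * X 2 + C a.1 * X 3) * he' + (C e.2 * X 2 - C e.1 * X 3) * h'
  rw [this]
  exact Ideal.mul_mem_left _ _ (ly_mem p)

lemma base_of_generic {Z : Fin 5 → (K × K) × (K × K)} (hZ : Mult1Generic K Z) : Base Z := by
  refine ⟨hZ.1, ?_, ?_, ?_⟩
  · intro i j hij h
    refine lx_ne_zero (hZ.1 i).1 (no_elem hZ {i, j} 1 0 ?_ (wh_lx _) ?_)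
    · rw [Finset.card_pair hij]
    · intro a ha
      rcases Finset.mem_insert.1 ha with rfl | ha
      · exact lx_mem _
      · rw [Finset.mem_singleton.1 ha]; exact lx_mem_of_projEq (hZ.1 j) h
  · intro i j hij h
    refine ly_ne_zero (hZ.1 i).2 (no_elem hZ {i, j} 0 1 ?_ (wh_ly _) ?_)
    · rw [Finset.card_pair hij]
    · intro a ha
      rcases Finset.mem_insert.1 ha with rfl | ha
      · exact ly_mem _
      · rw [Finset.mem_singleton.1 ha]; exact ly_mem_of_projEq (hZ.1 j) h
  · intro i0 α0 β0 α1 β1 h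
    have h0 : bil α0 β0 α1 β1 = 0 := by
      refine no_elem hZ (Finset.univ.erase i0) 1 1 ?_ (wh_bil _ _ _ _) ?_
      · simp
      · intro a ha
        exact bil_mem (hZ.1 a) (h a (Finset.ne_of_mem_erase ha))
    have e1 := congrArg (eval ![1, 0, 1, 0]) h0
    have e2 := congrArg (eval ![0, 1, 1, 0]) h0
    have e3 := congrArg (eval ![1, 0, 0, 1]) h0
    have e4 := congrArg (eval ![0, 1, 0, 1]) h0
    simp [bil] at e1 e2 e3 e4
    exact ⟨e1, e2, e3, e4⟩

lemma exists_root_quad [IsAlgClosed K] (s : K × K × K) : ∃ a : K × K, a ≠ 0 ∧ qv s a = 0 := by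
  by_cases h : s.1 = 0
  · exact ⟨(1, 0), by simp, by simp [qv, h]⟩
  · obtain ⟨x, hx⟩ := IsAlgClosed.exists_root
      (Polynomial.C s.1 * Polynomial.X ^ 2 + Polynomial.C s.2.1 * Polynomial.X
        + Polynomial.C s.2.2) (by rw [Polynomial.degree_quadratic h]; norm_num)
    refine ⟨(x, 1), by simp, ?_⟩
    simp [Polynomial.IsRoot] at hx
    simp [qv, hx]

lemma common_root [IsAlgClosed K] {s t : K × K × K} (h : res s t = 0) :
    ∃ a : K × K, a ≠ 0 ∧ qv s a = 0 ∧ qv t a = 0 := by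
  obtain ⟨A, B, D⟩ := s
  obtain ⟨A', B', D'⟩ := t
  simp only [res] at h
  by_cases hp : A * B' - A' * B = 0
  · by_cases hr : B * D' - B' * D = 0
    · have hq : A * D' - A' * D = 0 := by
        have : (A * D' - A' * D) ^ 2 = 0 := by rw [hp] at h; linear_combination h
        exact pow_eq_zero_iff (two_ne_zero) |>.1 this
      by_cases hA : A = 0
      · by_cases hB : B = 0
        · by_cases hD : D = 0
          · obtain ⟨a, ha, h1⟩ := exists_root_quad (A', B', D')
            exact ⟨a, ha, by simp [qv, hA, hB, hD], h1⟩
          · obtain ⟨a, ha, h1⟩ := exists_root_quad (A, B, D)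
            refine ⟨a, ha, h1, (mul_eq_zero.1 (?_ : D * qv (A', B', D') a = 0)).resolve_left hD⟩
            simp only [qv] at h1 ⊢
            linear_combination D' * h1 - a.1 ^ 2 * hq - a.1 * a.2 * hr
        · obtain ⟨a, ha, h1⟩ := exists_root_quad (A, B, D)
          refine ⟨a, ha, h1, (mul_eq_zero.1 (?_ : B * qv (A', B', D') a = 0)).resolve_left hB⟩
          simp only [qv] at h1 ⊢
          linear_combination B' * h1 - a.1 ^ 2 * hp + a.2 ^ 2 * hr
      · obtain ⟨a, ha, h1⟩ := exists_root_quad (A, B, D)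
        refine ⟨a, ha, h1, (mul_eq_zero.1 (?_ : A * qv (A', B', D') a = 0)).resolve_left hA⟩
        simp only [qv] at h1 ⊢
        linear_combination A' * h1 + a.1 * a.2 * hp + a.2 ^ 2 * hq
    · refine ⟨(B * D' - B' * D, -(A * D' - A' * D)), fun e => hr (congrArg Prod.fst e), ?_, ?_⟩
      · simp only [qv]; linear_combination D * h
      · simp only [qv]; linear_combination D' * h
  · refine ⟨(A * D' - A' * D, -(A * B' - A' * B)),
      fun e => hp (neg_eq_zero.1 (congrArg Prod.snd e)), ?_, ?_⟩
    · simp only [qv]; linear_combination A * h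
    · simp only [qv]; linear_combination A' * h

lemma projEq_trans {u v w : K × K} (hu : u ≠ 0) (h1 : ProjEq K u v) (h2 : ProjEq K u w) :
    ProjEq K v w := by
  unfold ProjEq at *
  by_cases h : u.1 = 0
  · have h' : u.2 ≠ 0 := fun h' => hu (Prod.ext h h')
    apply mul_left_cancel₀ h'
    linear_combination v.2 * h2 - w.2 * h1
  · apply mul_left_cancel₀ h
    linear_combination v.1 * h2 - w.1 * h1

/-- Evaluation of curves of bidegree (2,1) at the five points. -/
def evMap (Z : Fin 5 → (K × K) × (K × K)) : ((K × K × K) × (K × K × K)) →ₗ[K] (Fin 5 → K) where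
  toFun st i := qv st.1 (Z i).1 * (Z i).2.1 + qv st.2 (Z i).1 * (Z i).2.2
  map_add' x y := by
    ext i; simp [qv]; ring
  map_smul' c x := by
    ext i; simp [qv]; ring

lemma exists_good [IsAlgClosed K] {Z : Fin 5 → (K × K) × (K × K)} (hB : Base Z) :
    ∃ s t, Good Z s t := by
  have hker : LinearMap.ker (evMap Z) ≠ ⊥ :=
    LinearMap.ker_ne_bot_of_finrank_lt (by simp)
  obtain ⟨⟨s, t⟩, hst, hne⟩ := Submodule.exists_mem_ne_zero_of_ne_bot hker
  have hv : ∀ i, qv s (Z i).1 * (Z i).2.1 + qv t (Z i).1 * (Z i).2.2 = 0 :=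
    fun i => congrFun (LinearMap.mem_ker.1 hst) i
  refine ⟨s, t, hB.1, hB.2.1, fun hres => hne ?_, hv⟩
  obtain ⟨a, ha, hs, ht⟩ := common_root hres
  obtain ⟨α0, β0, u1, u2, u3⟩ := quad_factor s a ha hs
  obtain ⟨α1, β1, v1, v2, v3⟩ := quad_factor t a ha ht
  have hi0 : ∃ i0, ∀ i, i ≠ i0 → ¬ ProjEq K a (Z i).1 := by
    by_cases h : ∃ i0, ProjEq K a (Z i0).1
    · obtain ⟨i0, h0⟩ := h
      exact ⟨i0, fun i hi h => hB.2.1 i i0 hi (projEq_trans ha h h0)⟩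
    · push Not at h
      exact ⟨0, fun i _ => h i⟩
  obtain ⟨i0, hi0⟩ := hi0
  obtain ⟨z1, z2, z3, z4⟩ := hB.2.2.2 i0 α0 β0 α1 β1 (by
    intro i hi
    have hne : a.2 * (Z i).1.1 - a.1 * (Z i).1.2 ≠ 0 :=
      fun h => hi0 i hi (sub_eq_zero.1 h).symm
    apply (mul_eq_zero.1 (?_ : (a.2 * (Z i).1.1 - a.1 * (Z i).1.2) * _ = 0)).resolve_left hne
    have := hv i
    rw [qv, qv, ← u1, ← u2, ← u3, ← v1, ← v2, ← v3] at this
    linear_combination this)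
  subst z1 z2 z3 z4
  simp only [mul_zero, sub_zero] at u1 u2 u3 v1 v2 v3
  simp [Prod.ext_iff, ← u1, ← u2, ← u3, ← v1, ← v2, ← v3]

/-- Swapping the two factors. -/
def sw : P4 K →ₐ[K] P4 K := aeval ![X 2, X 3, X 0, X 1]

lemma sw_sw (f : P4 K) : sw (sw f) = f := by
  have : (sw.comp sw : P4 K →ₐ[K] P4 K) = AlgHom.id K _ := by
    ext i
    fin_cases i <;> simp [sw]
  exact DFunLike.congr_fun this f

lemma sw_lx (a : K × K) : sw (lx a) = ly a := by
  simp [sw, lx, ly, algebraMap_eq]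

lemma sw_ly (a : K × K) : sw (ly a) = lx a := by
  simp [sw, lx, ly, algebraMap_eq]

lemma sw_pt (p : (K × K) × (K × K)) (m : ℕ) {f : P4 K} (hf : f ∈ pointIdeal K p ^ m) :
    sw f ∈ pointIdeal K (p.2, p.1) ^ m := by
  refine pointIdeal_le_comap (sw : P4 K →ₐ[K] P4 K).toRingHom p _ ?_ ?_ hf
  · change sw (lx p.1) ∈ _
    rw [sw_lx]; exact ly_mem (p.2, p.1)
  · change sw (ly p.2) ∈ _
    rw [sw_ly]; exact lx_mem (p.2, p.1)

lemma wh_sw {a b : ℕ} {f : P4 K} (hf : f.IsWeightedHomogeneous w4 (a, b)) :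
    (sw f).IsWeightedHomogeneous w4 (b, a) := by
  refine wh_aeval ((AddMonoidHom.snd ℕ ℕ).prod (AddMonoidHom.fst ℕ ℕ)) _ ?_ hf
  intro i
  fin_cases i
  · exact wh_X 2
  · exact wh_X 3
  · exact wh_X 0
  · exact wh_X 1

/-- The swapped points. -/
def swZ (Z : Fin 5 → (K × K) × (K × K)) : Fin 5 → (K × K) × (K × K) := fun i => ((Z i).2, (Z i).1)

lemma sw_symb {Z : Fin 5 → (K × K) × (K × K)} {m : ℕ} {f : P4 K}
    (hf : f ∈ symbolicPower K Z m) : sw f ∈ symbolicPower K (swZ Z) m :=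
  mem_symb_iff.2 fun i => sw_pt (Z i) m (mem_symb_iff.1 hf i)

lemma sw_ideal {Z : Fin 5 → (K × K) × (K × K)} {m : ℕ} {f : P4 K}
    (hf : f ∈ idealOfPoints K (swZ Z) ^ m) : sw f ∈ idealOfPoints K Z ^ m := by
  have h : (idealOfPoints K (swZ Z)).map (sw : P4 K →ₐ[K] P4 K).toRingHom
      ≤ idealOfPoints K Z := by
    rw [Ideal.map_le_iff_le_comap]
    intro g hg
    rw [Ideal.mem_comap]
    refine mem_ideal_iff.2 fun i => ?_
    have := sw_pt (swZ Z i) 1 (f := g) (by rw [pow_one]; exact mem_ideal_iff.1 hg i)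
    rw [pow_one] at this
    exact this
  have h2 := Ideal.mem_map_of_mem (sw : P4 K →ₐ[K] P4 K).toRingHom hf
  rw [Ideal.map_pow] at h2
  exact Ideal.pow_right_mono h m h2

lemma base_sw {Z : Fin 5 → (K × K) × (K × K)} (hB : Base Z) : Base (swZ Z) := by
  refine ⟨fun i => ⟨(hB.1 i).2, (hB.1 i).1⟩, hB.2.2.1, hB.2.1, ?_⟩
  intro i0 α0 β0 α1 β1 h
  obtain ⟨h1, h2, h3, h4⟩ := hB.2.2.2 i0 α0 α1 β0 β1 (fun i hi => by
    have := h i hi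
    simp only [swZ] at this
    linear_combination this)
  exact ⟨h1, h3, h2, h4⟩

lemma symb_le [IsAlgClosed K] (m : ℕ) : ∀ {Z : Fin 5 → (K × K) × (K × K)}, Base Z →
    symbolicPower K Z m ≤ idealOfPoints K Z ^ m := by
  induction m with
  | zero => intro Z _; simp [Ideal.one_eq_top]
  | succ m ih =>
    intro Z hB f hf
    rw [← sum_weightedHomogeneousComponent w4 f,
      finsum_eq_sum _ (weightedHomogeneousComponent_finsupp f)]
    refine Ideal.sum_mem _ fun d _ => ?_
    have hd : weightedHomogeneousComponent w4 d f ∈ symbolicPower K Z (m + 1) :=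
      mem_symb_iff.2 fun i => pt_homog _ _ (mem_symb_iff.1 hf i) d
    have hw := weightedHomogeneousComponent_isWeightedHomogeneous (w := w4) d f
    obtain ⟨a, b⟩ := d
    rcases le_total b a with hab | hab
    · obtain ⟨s, t, hG⟩ := exists_good hB
      exact step hG (ih hB) hab hw hd
    · obtain ⟨s, t, hG⟩ := exists_good (base_sw hB)
      have := step hG (ih (base_sw hB)) hab (wh_sw hw) (sw_symb hd)
      rw [← sw_sw (weightedHomogeneousComponent w4 (a, b) f)]
      exact sw_ideal this

end FivePoints

/-- For five points of `P^1 × P^1` in multiplicity 1 generic position,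
`I^(m) = I^m` for all `m ≥ 1`. -/
theorem symbolic_eq_ordinary_five_points {k : Type*} [Field k] [IsAlgClosed k]
    (Z : Fin 5 → (k × k) × (k × k)) (hZ : Mult1Generic k Z)
    (m : ℕ) (hm : 1 ≤ m) :
    symbolicPower k Z m = idealOfPoints k Z ^ m := by
  exact le_antisymm (symb_le m (base_of_generic hZ)) (ideal_pow_le m)
end
end

section
/- Let t ≥ 2 and s = t^2, and let Z be a set of s points of P^1 x P^1 in multiplicity 1 generic position, with I = I(Z). Then for every integer n ≥ 1, the symbolic power I^((s-1)(2t-1)n) is not contained in the ordinary power I^(2s(t-1)n + 1). -/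
open MvPolynomial

noncomputable section

variable (k : Type*) [Field k]

attribute [local instance] MvPolynomial.weightedGradedAlgebra

lemma degree_of_weight (x : Fin 4 →₀ ℕ) :
    Finsupp.degree x = (Finsupp.weight w4 x).1 + (Finsupp.weight w4 x).2 := by
  rw [Finsupp.degree_eq_sum, Finsupp.weight_apply, Finsupp.sum_fintype _ _ (by simp)]
  simp [Fin.sum_univ_four, w4]
  ring

lemma pointIdeal_homog {k : Type*} [Field k] (p : (k × k) × (k × k)) :
    (pointIdeal k p).IsHomogeneous (weightedHomogeneousSubmodule k w4) := by
  refine Ideal.homogeneous_span _ _ ?_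
  intro x hx
  rcases hx with rfl | rfl
  · refine ⟨(1, 0), ?_⟩
    rw [mem_weightedHomogeneousSubmodule]
    exact ((isWeightedHomogeneous_X k w4 0).C_mul _).sub
      ((isWeightedHomogeneous_X k w4 1).C_mul _)
  · refine ⟨(0, 1), ?_⟩
    rw [mem_weightedHomogeneousSubmodule]
    exact ((isWeightedHomogeneous_X k w4 2).C_mul _).sub
      ((isWeightedHomogeneous_X k w4 3).C_mul _)

lemma whs_finite (k : Type*) [Field k] (d : ℕ × ℕ) :
    Module.Finite k (weightedHomogeneousSubmodule k w4 d) := by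
  have hfin : Finite {x : Fin 4 →₀ ℕ | Finsupp.weight w4 x = d} := by
    refine Set.Finite.subset (Finsupp.finite_of_degree_le (d.1 + d.2)) ?_
    intro x hx
    have := degree_of_weight x
    rw [Set.mem_ofPred_eq] at hx ⊢
    rw [hx] at this
    omega
  have : weightedHomogeneousSubmodule k w4 d
      = restrictSupport k {x : Fin 4 →₀ ℕ | Finsupp.weight w4 x = d} :=
    weightedHomogeneousSubmodule_eq_finsupp_supported k w4 d
  rw [this]
  exact Module.Finite.of_basis (basisRestrictSupport k _)

lemma ideal_le {k : Type*} [Field k] (t : ℕ) (ht : 2 ≤ t)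
    (Z : Fin (t ^ 2) → (k × k) × (k × k)) (hZ : Mult1Generic k Z) :
    idealOfPoints k Z ≤ idealOfVars (Fin 4) k ^ (2 * t - 1) := by
  intro f hf
  rw [mem_pow_idealOfVars_iff]
  intro x hx
  by_contra hlt
  have hh : (idealOfPoints k Z).IsHomogeneous (weightedHomogeneousSubmodule k w4) :=
    Ideal.IsHomogeneous.iInf fun i => pointIdeal_homog (Z i)
  rcases hd : Finsupp.weight w4 x with ⟨i, j⟩
  have hm := (mem_iff_weightedHomogeneousComponent_mem k w4 hh f).1 hf (i, j)
  have hdeg := degree_of_weight x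
  rw [hd] at hdeg
  have hr := hZ.2.2 Finset.univ i j
  have h0 : (i + 1) * (j + 1) - (Finset.univ : Finset (Fin (t ^ 2))).card = 0 := by
    simp only [Finset.card_univ, Fintype.card_fin]
    apply Nat.sub_eq_zero_of_le
    have : (i + 1) + (j + 1) ≤ 2 * t := by simp only at hdeg; omega
    zify at *
    nlinarith [sq_nonneg ((i:ℤ) - j)]
  rw [h0] at hr
  have := whs_finite k (i, j)
  have hfd : Module.Finite k ↥(bipiece k (⨅ a ∈ Finset.univ, pointIdeal k (Z a)) (i, j)) :=
    Submodule.finiteDimensional_of_le inf_le_right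
  have hbot := Submodule.finrank_eq_zero.1 hr
  have hmem : weightedHomogeneousComponent w4 (i, j) f ∈
      bipiece k (⨅ a ∈ Finset.univ, pointIdeal k (Z a)) (i, j) := by
    refine ⟨?_, weightedHomogeneousComponent_mem w4 f (i, j)⟩
    simpa [idealOfPoints] using hm
  rw [hbot, Submodule.mem_bot] at hmem
  have hc := congrArg (coeff x) hmem
  rw [coeff_weightedHomogeneousComponent, if_pos hd] at hc
  exact (mem_support_iff.1 hx) (by simpa using hc)

lemma exists_form {k : Type*} [Field k] (t : ℕ) (ht : 2 ≤ t)
    (Z : Fin (t ^ 2) → (k × k) × (k × k)) (hZ : Mult1Generic k Z) (a : Fin (t ^ 2)) :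
    ∃ F : MvPolynomial (Fin 4) k, F ≠ 0 ∧ F.IsWeightedHomogeneous w4 (t - 1, t - 1) ∧
      ∀ b, b ≠ a → F ∈ pointIdeal k (Z b) := by
  have hr := hZ.2.2 (Finset.univ.erase a) (t - 1) (t - 1)
  rw [Finset.card_erase_of_mem (Finset.mem_univ a), Finset.card_univ, Fintype.card_fin,
    Nat.sub_add_cancel (by omega), ← pow_two] at hr
  have hpos : 0 < t ^ 2 := by positivity
  have hne : bipiece k (⨅ b ∈ Finset.univ.erase a, pointIdeal k (Z b)) (t - 1, t - 1) ≠ ⊥ := by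
    intro h
    rw [h, finrank_bot] at hr
    omega
  obtain ⟨F, hF, hF0⟩ := Submodule.exists_mem_ne_zero_of_ne_bot hne
  refine ⟨F, hF0, hF.2, fun b hb => ?_⟩
  have h1 : F ∈ ⨅ b ∈ Finset.univ.erase a, pointIdeal k (Z b) := hF.1
  simp only [Ideal.mem_iInf] at h1
  exact h1 b (by simp [hb])

/-- For `s = t^2` (`t ≥ 2`) points of `P^1 × P^1` in multiplicity 1
generic position, `I^((s-1)(2t-1)n) ⊄ I^(2s(t-1)n + 1)` for every `n ≥ 1`. -/
theorem symbolic_not_in_ordinary_square_points {k : Type*} [Field k] [IsAlgClosed k]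
    (t : ℕ) (ht : 2 ≤ t)
    (Z : Fin (t ^ 2) → (k × k) × (k × k)) (hZ : Mult1Generic k Z)
    (n : ℕ) (hn : 1 ≤ n) :
    ¬ symbolicPower k Z ((t ^ 2 - 1) * (2 * t - 1) * n)
        ≤ idealOfPoints k Z ^ (2 * t ^ 2 * (t - 1) * n + 1) := by
  choose F hF0 hFh hFm using exists_form t ht Z hZ
  intro hle
  set N := (2 * t - 1) * n with hN
  have hmem : (∏ a, F a) ^ N ∈ symbolicPower k Z ((t ^ 2 - 1) * (2 * t - 1) * n) := by
    simp only [symbolicPower, Ideal.mem_iInf]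
    intro b
    rw [mul_assoc, pow_mul]
    apply Ideal.pow_mem_pow
    rw [← Finset.mul_prod_erase _ _ (Finset.mem_univ b)]
    apply Ideal.mul_mem_left
    have h := Ideal.prod_mem_prod (s := Finset.univ.erase b)
      (I := fun _ => pointIdeal k (Z b)) (x := F)
      (fun a ha => hFm a b (Finset.ne_of_mem_erase ha).symm)
    simpa [Finset.card_erase_of_mem] using h
  have h1 := Ideal.pow_right_mono (ideal_le t ht Z hZ) _ (hle hmem)
  rw [← pow_mul, mem_pow_idealOfVars_iff] at h1
  have hne : (∏ a, F a) ^ N ≠ 0 := pow_ne_zero _ (Finset.prod_ne_zero_iff.2 fun a _ => hF0 a)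
  have hhom := (IsWeightedHomogeneous.prod Finset.univ F (fun _ => (t - 1, t - 1))
    (fun a _ => hFh a)).pow N
  obtain ⟨x, hx⟩ := support_nonempty.2 hne
  have h2 := h1 x hx
  have h3 := hhom (mem_support_iff.1 hx)
  rw [degree_of_weight, h3] at h2
  simp at h2
  obtain ⟨u, rfl⟩ := Nat.exists_eq_add_of_le ht
  have e1 : 2 * (2 + u) - 1 = 2 * u + 3 := by omega
  have e2 : 2 + u - 1 = u + 1 := by omega
  rw [e1] at h2 hN
  rw [e2] at h2
  rw [hN] at h2
  ring_nf at h2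
  omega
end
end
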